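/- arXiv:math/0304035 — 8 statements merged into one kernel-verified Lean document; each statement's English description precedes it below -/
import Mathlib

section
/- For all α, β ∈ F with αβ ≠ 0, the bracket [L_{i,j}, L_{k,ℓ}] = ((i+α)(ℓ−β)−(k+α)(j−β))L_{i+k,j+ℓ} (with L_{i,j} = 0 for (i,j) ∉ Z) on the free F-module with basis {L_{i,j} : (i,j) ∈ Z} is alternating and satisfies the Jacobi identity, so the Block algebra B(α,β) is a ℤ×ℤ-graded Lie algebra over F. -/
open Finsupp

/-- Bilinear extension of structure constants `c` to the free module with basis `ι`. -/
noncomputable def brkt {F : Type*} [Field F] {ι : Type*} (c : ι → ι → (ι →₀ F))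
    (x y : ι →₀ F) : ι →₀ F :=
  Finsupp.sum x fun i a => Finsupp.sum y fun j b => (a * b) • c i j

/-- The index set `Z = ℤ×ℤ ∖ {(−α,β), (−2α,2β)}`. -/
def ZS {F : Type*} [Field F] (α β : F) : Set (ℤ × ℤ) :=
  {p | ¬((p.1 : F) = -α ∧ (p.2 : F) = β) ∧ ¬((p.1 : F) = -2 * α ∧ (p.2 : F) = 2 * β)}

-- Structure constants of the Block algebra `B(α,β)`:
-- `[L_{i,j}, L_{k,ℓ}] = ((i+α)(ℓ−β) − (k+α)(j−β)) L_{i+k,j+ℓ}`, with the convention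
-- `L_{i,j} = 0` for `(i,j) ∉ Z`.
open Classical in
noncomputable def cB {F : Type*} [Field F] (α β : F) (p q : ↥(ZS α β)) :
    ↥(ZS α β) →₀ F :=
  if h : (p.1 + q.1 : ℤ × ℤ) ∈ ZS α β then
    Finsupp.single ⟨p.1 + q.1, h⟩
      (((p.1.1 : F) + α) * ((q.1.2 : F) - β) - ((q.1.1 : F) + α) * ((p.1.2 : F) - β))
  else 0

section Bilinear

variable {F : Type*} [Field F] {ι : Type*} (c : ι → ι → (ι →₀ F))

lemma brkt_zero_left (y : ι →₀ F) : brkt c 0 y = 0 := by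
  simp [brkt]

lemma brkt_zero_right (x : ι →₀ F) : brkt c x 0 = 0 := by
  simp [brkt]

lemma brkt_add_left (x x' y : ι →₀ F) : brkt c (x + x') y = brkt c x y + brkt c x' y := by
  unfold brkt
  refine Finsupp.sum_add_index' (fun i => by simp) fun i a b => ?_
  rw [← Finsupp.sum_add]
  simp only [add_mul, add_smul]

lemma brkt_add_right (x y y' : ι →₀ F) : brkt c x (y + y') = brkt c x y + brkt c x y' := by
  unfold brkt
  rw [← Finsupp.sum_add]
  refine Finsupp.sum_congr fun i _ => ?_
  exact Finsupp.sum_add_index' (fun i => by simp) fun i a b => by rw [mul_add, add_smul]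

lemma brkt_single_single (i j : ι) (a b : F) :
    brkt c (Finsupp.single i a) (Finsupp.single j b) = (a * b) • c i j := by
  simp [brkt]

lemma brkt_smul_right (t : F) (x y : ι →₀ F) : brkt c x (t • y) = t • brkt c x y := by
  induction y using Finsupp.induction_linear with
  | zero => simp [brkt_zero_right]
  | add f g hf hg => rw [smul_add, brkt_add_right, brkt_add_right, hf, hg, smul_add]
  | single j b =>
    induction x using Finsupp.induction_linear with
    | zero => simp [brkt_zero_left]
    | add f g hf hg => rw [brkt_add_left, brkt_add_left, hf, hg, smul_add]
    | single i a =>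
      rw [Finsupp.smul_single, brkt_single_single, brkt_single_single, smul_smul, smul_eq_mul,
        mul_left_comm]

/-- Skew-symmetry of the bracket follows from skew-symmetry of the structure constants. -/
lemma brkt_skew (hc : ∀ i j, c i j = -c j i) (x y : ι →₀ F) :
    brkt c x y = -brkt c y x := by
  induction x using Finsupp.induction_linear with
  | zero => simp [brkt_zero_left, brkt_zero_right]
  | add f g hf hg => rw [brkt_add_left, brkt_add_right, hf, hg, neg_add]
  | single i a =>
    induction y using Finsupp.induction_linear with
    | zero => simp [brkt_zero_left, brkt_zero_right]
    | add f g hf hg => rw [brkt_add_left, brkt_add_right, hf, hg, neg_add]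
    | single j b =>
      rw [brkt_single_single, brkt_single_single, hc i j, smul_neg, mul_comm]

lemma brkt_self (hc : ∀ i j, c i j = -c j i) (hc' : ∀ i, c i i = 0) (x : ι →₀ F) :
    brkt c x x = 0 := by
  induction x using Finsupp.induction_linear with
  | zero => exact brkt_zero_left c 0
  | add f g hf hg =>
    rw [brkt_add_left, brkt_add_right, brkt_add_right, hf, hg, brkt_skew c hc f g]
    simp
  | single i a => rw [brkt_single_single, hc', smul_zero]

/-- The Jacobi identity need only be checked on multiples of basis vectors. -/
lemma brkt_jacobi_of_single
    (h : ∀ (i j k : ι) (a b d : F),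
      brkt c (Finsupp.single i a) (brkt c (Finsupp.single j b) (Finsupp.single k d)) +
        brkt c (Finsupp.single j b) (brkt c (Finsupp.single k d) (Finsupp.single i a)) +
        brkt c (Finsupp.single k d) (brkt c (Finsupp.single i a) (Finsupp.single j b)) = 0)
    (x y z : ι →₀ F) :
    brkt c x (brkt c y z) + brkt c y (brkt c z x) + brkt c z (brkt c x y) = 0 := by
  induction x using Finsupp.induction_linear with
  | zero => simp [brkt_zero_left, brkt_zero_right]
  | add f g hf hg =>
    simp only [brkt_add_left, brkt_add_right]
    rw [← add_zero (0 : ι →₀ F)]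
    nth_rewrite 1 [← hf]
    rw [← hg]
    abel
  | single i a =>
    induction y using Finsupp.induction_linear with
    | zero => simp [brkt_zero_left, brkt_zero_right]
    | add f g hf hg =>
      simp only [brkt_add_left, brkt_add_right]
      rw [← add_zero (0 : ι →₀ F)]
      nth_rewrite 1 [← hf]
      rw [← hg]
      abel
    | single j b =>
      induction z using Finsupp.induction_linear with
      | zero => simp [brkt_zero_left, brkt_zero_right]
      | add f g hf hg =>
        simp only [brkt_add_left, brkt_add_right]
        rw [← add_zero (0 : ι →₀ F)]
        nth_rewrite 1 [← hf]
        rw [← hg]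
        abel
      | single k d => exact h i j k a b d

end Bilinear

section Block

variable {F : Type*} [Field F] (α β : F)

/-- The coefficient `(i+α)(ℓ−β) − (k+α)(j−β)`, defined on all of `ℤ × ℤ`. -/
def blockCoeff (m n : ℤ × ℤ) : F :=
  ((m.1 : F) + α) * ((n.2 : F) - β) - ((n.1 : F) + α) * ((m.2 : F) - β)

open Classical in
/-- The vector `L_n`, with the convention `L_n = 0` for `n ∉ Z`. -/
noncomputable def blockVec (n : ℤ × ℤ) : ↥(ZS α β) →₀ F :=
  if h : n ∈ ZS α β then Finsupp.single ⟨n, h⟩ 1 else 0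

lemma blockVec_of_mem {n : ℤ × ℤ} (h : n ∈ ZS α β) :
    blockVec α β n = Finsupp.single ⟨n, h⟩ 1 := by
  simp [blockVec, h]

lemma blockVec_of_notMem {n : ℤ × ℤ} (h : n ∉ ZS α β) : blockVec α β n = 0 := by
  simp [blockVec, h]

lemma cB_eq_smul_blockVec (p q : ↥(ZS α β)) :
    cB α β p q = blockCoeff α β p q • blockVec α β (p + q) := by
  by_cases h : (p.1 + q.1 : ℤ × ℤ) ∈ ZS α β
  · simp [cB, h, blockVec_of_mem, blockCoeff]
  · simp [cB, h, blockVec_of_notMem]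

lemma blockCoeff_skew (m n : ℤ × ℤ) : blockCoeff α β m n = -blockCoeff α β n m := by
  unfold blockCoeff
  ring

lemma cB_skew (p q : ↥(ZS α β)) : cB α β p q = -cB α β q p := by
  rw [cB_eq_smul_blockVec, cB_eq_smul_blockVec, blockCoeff_skew, neg_smul, add_comm]

lemma cB_self (p : ↥(ZS α β)) : cB α β p p = 0 := by
  rw [cB_eq_smul_blockVec, blockCoeff, sub_self, zero_smul]

/-- The removed indices do no harm: `L_{−α,β}` would be central, and `L_{−2α,2β}` is never
produced by a bracket. -/
lemma blockCoeff_mul_eq_zero {n k : ℤ × ℤ} (h : n + k ∉ ZS α β) (m : ℤ × ℤ) :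
    blockCoeff α β n k * blockCoeff α β m (n + k) = 0 := by
  simp only [ZS, Set.mem_ofPred_eq, Prod.fst_add, Prod.snd_add, Int.cast_add] at h
  have h' := not_and_or.mp h
  simp only [not_not] at h'
  simp only [blockCoeff, Prod.fst_add, Prod.snd_add, Int.cast_add]
  rcases h' with ⟨h₁, h₂⟩ | ⟨h₁, h₂⟩
  · rw [h₁, h₂]
    ring
  · rw [eq_sub_of_add_eq h₁, eq_sub_of_add_eq h₂]
    ring

lemma brkt_single_cB (p q r : ↥(ZS α β)) (a : F) :
    brkt (cB α β) (Finsupp.single p a) (cB α β q r) =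
      (a * (blockCoeff α β q r * blockCoeff α β p (q + r))) •
        blockVec α β (p + (q + r)) := by
  rw [cB_eq_smul_blockVec, brkt_smul_right]
  by_cases h : (q.1 + r.1 : ℤ × ℤ) ∈ ZS α β
  · rw [blockVec_of_mem α β h, brkt_single_single, cB_eq_smul_blockVec, smul_smul, smul_smul]
    congr 1
    ring
  · rw [blockVec_of_notMem α β h, brkt_zero_right, blockCoeff_mul_eq_zero α β h]
    simp

lemma blockCoeff_jacobi (m n k : ℤ × ℤ) :
    blockCoeff α β n k * blockCoeff α β m (n + k) +
      blockCoeff α β k m * blockCoeff α β n (k + m) +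
      blockCoeff α β m n * blockCoeff α β k (m + n) = 0 := by
  simp only [blockCoeff, Prod.fst_add, Prod.snd_add, Int.cast_add]
  ring

lemma brkt_cB_jacobi_single (p q r : ↥(ZS α β)) (a b d : F) :
    brkt (cB α β) (Finsupp.single p a)
        (brkt (cB α β) (Finsupp.single q b) (Finsupp.single r d)) +
      brkt (cB α β) (Finsupp.single q b)
        (brkt (cB α β) (Finsupp.single r d) (Finsupp.single p a)) +
      brkt (cB α β) (Finsupp.single r d)
        (brkt (cB α β) (Finsupp.single p a) (Finsupp.single q b)) = 0 := by
  have hq : (q + (r + p) : ℤ × ℤ) = p + (q + r) := by abel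
  have hr : (r + (p + q) : ℤ × ℤ) = p + (q + r) := by abel
  simp only [brkt_single_single, brkt_smul_right, brkt_single_cB, smul_smul, hq, hr, ← add_smul]
  rw [show ∀ u v w : F, b * d * (a * u) + d * a * (b * v) + a * b * (d * w) =
    a * b * d * (u + v + w) from fun u v w => by ring, blockCoeff_jacobi, mul_zero, zero_smul]

lemma cB_apply_of_ne {p q r : ↥(ZS α β)} (h : (r : ℤ × ℤ) ≠ p + q) : cB α β p q r = 0 := by
  unfold cB
  split_ifs with hpq
  · exact Finsupp.single_eq_of_ne fun hr => h (congrArg Subtype.val hr)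
  · rfl

end Block

theorem stmt_5 {F : Type*} [Field F] [CharZero F] (α β : F) (hαβ : α * β ≠ 0) :
    -- the bracket of B(α,β) is alternating
    (∀ x : ↥(ZS α β) →₀ F, brkt (cB α β) x x = 0) ∧
    -- and satisfies the Jacobi identity
    (∀ x y z : ↥(ZS α β) →₀ F,
      brkt (cB α β) x (brkt (cB α β) y z) + brkt (cB α β) y (brkt (cB α β) z x) +
        brkt (cB α β) z (brkt (cB α β) x y) = 0) ∧
    -- hence B(α,β) is a ℤ×ℤ-graded Lie algebra: the bracket of basis vectors of
    -- degrees p and q is concentrated in degree p + q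
    (∀ p q r : ↥(ZS α β), (r : ℤ × ℤ) ≠ (p : ℤ × ℤ) + (q : ℤ × ℤ) →
      brkt (cB α β) (Finsupp.single p (1 : F)) (Finsupp.single q (1 : F)) r = 0) := by
  refine ⟨brkt_self _ (cB_skew α β) (cB_self α β),
    brkt_jacobi_of_single _ (brkt_cB_jacobi_single α β), fun p q r h => ?_⟩
  rw [brkt_single_single, Finsupp.smul_apply, cB_apply_of_ne α β h, smul_zero]
end

section
/- For every α ∈ F∖{0} and all a₁, a₂, a₂′ ∈ F: the subspace of B(α,−1;a₁,a₂,a₂′) spanned by {L_{i,j} : (i,j) ∈ Z, j ≥ −1} ∪ {c₁, c₂} is a Lie subalgebra (denoted B⁺(α,−1;a₁,a₂,a₂′)), and the subspace of B(α,1;a₁,a₂,a₂′) spanned by {L_{i,j} : (i,j) ∈ Z, j ≤ 1} ∪ {c₁, c₂} is a Lie subalgebra (denoted B⁺(α,1;a₁,a₂,a₂′)). -/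
open Finsupp

-- Structure constants of `B(α,β;a₁,a₂,a₂′) = B(α,β) ⊕ F c₁ ⊕ F c₂`, where `Sum.inr 0`
-- plays the role of `c₁` and `Sum.inr 1` the role of `c₂`, and `c₁, c₂` are central.
open Classical in
noncomputable def cBE {F : Type*} [Field F] (α β a1 a2 a2' : F) :
    (↥(ZS α β) ⊕ Fin 2) → (↥(ZS α β) ⊕ Fin 2) → ((↥(ZS α β) ⊕ Fin 2) →₀ F)
  | Sum.inl p, Sum.inl q =>
      (if h : (p.1 + q.1 : ℤ × ℤ) ∈ ZS α β then
        Finsupp.single (Sum.inl ⟨p.1 + q.1, h⟩)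
          (((p.1.1 : F) + α) * ((q.1.2 : F) - β) - ((q.1.1 : F) + α) * ((p.1.2 : F) - β))
      else 0)
      + Finsupp.single (Sum.inr 0)
          (if ((p.1.1 + q.1.1 : ℤ) : F) = -α ∧ ((p.1.2 + q.1.2 : ℤ) : F) = β then
            (α * (p.1.2 : F) + β * (p.1.1 : F)) * a1
          else 0)
      + Finsupp.single (Sum.inr 1)
          (if ((p.1.1 + q.1.1 : ℤ) : F) = -2 * α ∧ ((p.1.2 + q.1.2 : ℤ) : F) = 2 * β then
            a2 * (α * (p.1.2 : F) + β * (p.1.1 : F)) + a2' * (α + (p.1.1 : F))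
          else 0)
  | _, _ => 0

/-- The span of `{L_{i,j} : (i,j) ∈ Z, j ≥ −1} ∪ {c₁, c₂}` inside `B(α,−1;a₁,a₂,a₂′)`. -/
noncomputable def BplusLow {F : Type*} [Field F] (α : F) :
    Submodule F ((↥(ZS α (-1 : F)) ⊕ Fin 2) →₀ F) :=
  Submodule.span F
    ({v | ∃ p : ↥(ZS α (-1 : F)), -1 ≤ p.1.2 ∧ v = Finsupp.single (Sum.inl p) (1 : F)} ∪
      {Finsupp.single (Sum.inr 0) 1, Finsupp.single (Sum.inr 1) 1})

/-- The span of `{L_{i,j} : (i,j) ∈ Z, j ≤ 1} ∪ {c₁, c₂}` inside `B(α,1;a₁,a₂,a₂′)`. -/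
noncomputable def BplusHigh {F : Type*} [Field F] (α : F) :
    Submodule F ((↥(ZS α (1 : F)) ⊕ Fin 2) →₀ F) :=
  Submodule.span F
    ({v | ∃ p : ↥(ZS α (1 : F)), p.1.2 ≤ 1 ∧ v = Finsupp.single (Sum.inl p) (1 : F)} ∪
      {Finsupp.single (Sum.inr 0) 1, Finsupp.single (Sum.inr 1) 1})

/-- If the structure constants of indices in `S` are supported on `S`, then the vectors supported
on `S` are closed under the bracket. -/
theorem brkt_mem_supported {F : Type*} [Field F] {ι : Type*} {c : ι → ι → (ι →₀ F)} {S : Set ι}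
    (hc : ∀ i ∈ S, ∀ j ∈ S, c i j ∈ Finsupp.supported F F S) {x y : ι →₀ F}
    (hx : x ∈ Finsupp.supported F F S) (hy : y ∈ Finsupp.supported F F S) :
    brkt c x y ∈ Finsupp.supported F F S :=
  Submodule.sum_mem _ fun i hi => Submodule.sum_mem _ fun j hj =>
    Submodule.smul_mem _ _ (hc i (hx hi) j (hy hj))

/-- The indices `(i, j)` with `j` satisfying `P`, together with both central indices. -/
def levelIndices {F : Type*} [Field F] (α β : F) (P : ℤ → Prop) : Set (↥(ZS α β) ⊕ Fin 2) :=
  {s | ∀ p, s = Sum.inl p → P p.1.2}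

theorem span_level_eq_supported {F : Type*} [Field F] (α β : F) (P : ℤ → Prop) :
    Submodule.span F
      ({v | ∃ p : ↥(ZS α β), P p.1.2 ∧ v = Finsupp.single (Sum.inl p) (1 : F)} ∪
        {Finsupp.single (Sum.inr 0) 1, Finsupp.single (Sum.inr 1) 1}) =
      Finsupp.supported F F (levelIndices α β P) := by
  rw [Finsupp.supported_eq_span_single]
  congr 1
  ext v
  constructor
  · rintro (⟨p, hp, rfl⟩ | rfl | rfl)
    · exact ⟨Sum.inl p, fun q hq => Sum.inl.inj hq ▸ hp, rfl⟩
    · exact ⟨Sum.inr 0, fun q hq => (Sum.inr_ne_inl hq).elim, rfl⟩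
    · exact ⟨Sum.inr 1, fun q hq => (Sum.inr_ne_inl hq).elim, rfl⟩
  · rintro ⟨p | k, hs, rfl⟩
    · exact Or.inl ⟨p, hs p rfl, rfl⟩
    · fin_cases k
      · exact Or.inr (Or.inl rfl)
      · exact Or.inr (Or.inr rfl)

/-- The coefficient of `L_{i+k,j+ℓ}` in `[L_{i,j}, L_{k,ℓ}]` vanishes when `j = ℓ = β`, so `P` need
only be additively closed away from that case. -/
theorem cBE_mem_supported {F : Type*} [Field F] (α β a1 a2 a2' : F) {P : ℤ → Prop}
    (hP : ∀ j l : ℤ, P j → P l → P (j + l) ∨ ((j : F) = β ∧ (l : F) = β))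
    (s : ↥(ZS α β) ⊕ Fin 2) (hs : s ∈ levelIndices α β P)
    (t : ↥(ZS α β) ⊕ Fin 2) (ht : t ∈ levelIndices α β P) :
    cBE α β a1 a2 a2' s t ∈ Finsupp.supported F F (levelIndices α β P) := by
  have central (k : Fin 2) (a : F) :
      Finsupp.single (Sum.inr k) a ∈ Finsupp.supported F F (levelIndices α β P) :=
    Finsupp.single_mem_supported F a fun q hq => (Sum.inr_ne_inl hq).elim
  rcases s with p | _ <;> rcases t with q | _
  · refine Submodule.add_mem _ (Submodule.add_mem _ ?_ (central 0 _)) (central 1 _)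
    split_ifs with h
    · rcases hP _ _ (hs p rfl) (ht q rfl) with hpq | ⟨hp, hq⟩
      · exact Finsupp.single_mem_supported F _ fun r hr => Sum.inl.inj hr ▸ hpq
      · simp [hp, hq]
    · exact Submodule.zero_mem _
  all_goals exact Submodule.zero_mem _

theorem stmt_7 {F : Type*} [Field F] [CharZero F] (α : F) (hα : α ≠ 0)
    (a1 a2 a2' : F) :
    -- B⁺(α,−1;a₁,a₂,a₂′) is closed under the bracket of B(α,−1;a₁,a₂,a₂′)
    (∀ x ∈ BplusLow α, ∀ y ∈ BplusLow α,
      brkt (cBE α (-1 : F) a1 a2 a2') x y ∈ BplusLow α) ∧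
    -- B⁺(α,1;a₁,a₂,a₂′) is closed under the bracket of B(α,1;a₁,a₂,a₂′)
    (∀ x ∈ BplusHigh α, ∀ y ∈ BplusHigh α,
      brkt (cBE α (1 : F) a1 a2 a2') x y ∈ BplusHigh α) := by
  constructor
  · rw [BplusLow, span_level_eq_supported α (-1) (-1 ≤ ·)]
    refine fun x hx y hy => brkt_mem_supported (cBE_mem_supported α (-1) a1 a2 a2' ?_) hx hy
    intro j l hj hl
    by_cases h : -1 ≤ j + l
    · exact Or.inl h
    · obtain ⟨rfl, rfl⟩ : j = -1 ∧ l = -1 := by omega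
      simp
  · rw [BplusHigh, span_level_eq_supported α 1 (· ≤ 1)]
    refine fun x hx y hy => brkt_mem_supported (cBE_mem_supported α 1 a1 a2 a2' ?_) hx hy
    intro j l hj hl
    by_cases h : j + l ≤ 1
    · exact Or.inl h
    · obtain ⟨rfl, rfl⟩ : j = 1 ∧ l = 1 := by omega
      simp
end

section
/- For every α ∈ F∖{0}, the subspace C⁻(α) = ⊕_{i∈ℤ, j≤−2}FL_{i,j} is an abelian ideal of C(α), and the quotient Lie algebra C(α)/C⁻(α) is isomorphic to B⁺(−α,−1;1,0,0). -/
open Finsupp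

/-- The coefficients `a_{i,j,k,ℓ}` of `C(α)` in the explicitly listed cases. -/
noncomputable def aC0 {F : Type*} [Field F] (α : F) (i j k l : ℤ) : F :=
  if -1 ≤ j ∧ -1 ≤ l ∧ -1 ≤ j + l then
    ((k * (j + 1) - (l + 1) * i : ℤ) : F) + ((l - j : ℤ) : F) * α
  else if j = -1 ∧ l = -1 then ((k - i : ℤ) : F)
  else if 0 ≤ j ∧ l ≤ -2 then
    (if 0 ≤ -l - j - 2 then
      (((-l - 2).toNat.factorial / (-l - j - 2).toNat.factorial : ℕ) : F) *
        (((k * (j + 1) - (l + 1) * i : ℤ) : F) + ((l - j : ℤ) : F) * α)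
    else 0)
  else if j = -1 ∧ l ≤ -2 then -α + (i : F)
  else 0

/-- The full family of coefficients `a_{i,j,k,ℓ}` of `C(α)`; in the remaining cases
they are given by anticommutativity: `a_{i,j,k,ℓ} = −a_{k,ℓ,i,j}`. -/
noncomputable def aC {F : Type*} [Field F] (α : F) (i j k l : ℤ) : F :=
  if -1 ≤ j ∨ l ≤ -2 then aC0 α i j k l else -aC0 α k l i j

/-- Structure constants of `C(α)`: `[L_{i,j}, L_{k,ℓ}] = a_{i,j,k,ℓ} L_{i+k, j+ℓ}`. -/
noncomputable def cC {F : Type*} [Field F] (α : F) (p q : ℤ × ℤ) : (ℤ × ℤ) →₀ F :=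
  Finsupp.single (p + q) (aC α p.1 p.2 q.1 q.2)

/-- `C⁻(α) = ⊕_{i∈ℤ, j≤−2} F L_{i,j}`. -/
noncomputable def Cminus (F : Type*) [Field F] : Submodule F ((ℤ × ℤ) →₀ F) :=
  Submodule.span F {v | ∃ p : ℤ × ℤ, p.2 ≤ -2 ∧ v = Finsupp.single p (1 : F)}

/-- Index set of `B⁺(γ,−1;1,0,0)`: pairs `(i,j) ∈ Z = ℤ×ℤ ∖ {(−γ,−1),(−2γ,−2)}` with
`j ≥ −1`, together with the central element `c₁` (present when `(−γ,−1) ∈ ℤ×ℤ`). -/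
def BpIdx {F : Type*} [Field F] (γ : F) : Set ((ℤ × ℤ) ⊕ Unit) :=
  {x | Sum.elim
    (fun p : ℤ × ℤ =>
      (¬((p.1 : F) = -γ ∧ (p.2 : F) = -1) ∧ ¬((p.1 : F) = -2 * γ ∧ (p.2 : F) = -2)) ∧
        -1 ≤ p.2)
    (fun _ => ∃ p : ℤ × ℤ, (p.1 : F) = -γ ∧ (p.2 : F) = -1) x}

-- Structure constants of `B⁺(γ,−1;1,0,0)`:
-- `[L_{i,j},L_{k,ℓ}] = ((i+γ)(ℓ+1) − (k+γ)(j+1)) L_{i+k,j+ℓ} + δ_{i+k,−γ} δ_{j+ℓ,−1} (γj−i) c₁`,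
-- with `c₁` central and `L_{i,j} = 0` for `(i,j)` outside the index set.
open Classical in
noncomputable def cBp {F : Type*} [Field F] (γ : F) :
    ↥(BpIdx γ) → ↥(BpIdx γ) → (↥(BpIdx γ) →₀ F) := fun x y =>
  match x, y with
  | ⟨Sum.inl p, _⟩, ⟨Sum.inl q, _⟩ =>
      (if h : (Sum.inl (p + q) : (ℤ × ℤ) ⊕ Unit) ∈ BpIdx γ then
        Finsupp.single ⟨Sum.inl (p + q), h⟩
          (((p.1 : F) + γ) * ((q.2 : F) + 1) - ((q.1 : F) + γ) * ((p.2 : F) + 1))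
      else 0)
      + (if h : (Sum.inr () : (ℤ × ℤ) ⊕ Unit) ∈ BpIdx γ then
          Finsupp.single ⟨Sum.inr (), h⟩
            (if ((p.1 + q.1 : ℤ) : F) = -γ ∧ ((p.2 + q.2 : ℤ) : F) = -1 then
              γ * (p.2 : F) - (p.1 : F)
            else 0)
        else 0)
  | _, _ => 0

/-- The bracket with structure constants `c`, as a bilinear map. -/
noncomputable def brktBilin {F : Type*} [Field F] {ι : Type*} (c : ι → ι → (ι →₀ F)) :
    (ι →₀ F) →ₗ[F] (ι →₀ F) →ₗ[F] (ι →₀ F) :=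
  Finsupp.linearCombination F fun i => Finsupp.linearCombination F (c i)

theorem brktBilin_apply {F : Type*} [Field F] {ι : Type*} (c : ι → ι → (ι →₀ F))
    (x y : ι →₀ F) : brktBilin c x y = brkt c x y := by
  simp only [brktBilin, brkt, Finsupp.linearCombination_apply, Finsupp.sum,
    LinearMap.sum_apply, LinearMap.smul_apply, Finset.smul_sum, smul_smul]

theorem brktBilin_single {F : Type*} [Field F] {ι : Type*} (c : ι → ι → (ι →₀ F))
    (i j : ι) (a b : F) :
    brktBilin c (Finsupp.single i a) (Finsupp.single j b) = (a * b) • c i j := by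
  simp [brktBilin, smul_smul]

theorem single_mem_Cminus {F : Type*} [Field F] {p : ℤ × ℤ} (hp : p.2 ≤ -2) (a : F) :
    Finsupp.single p a ∈ Cminus F := by
  have h : Finsupp.single p (1 : F) ∈ Cminus F := Submodule.subset_span ⟨p, hp, rfl⟩
  simpa using (Cminus F).smul_mem a h

theorem aC_eq_zero_of_le_of_le {F : Type*} [Field F] (α : F) (i k : ℤ) {j l : ℤ}
    (hj : j ≤ -2) (hl : l ≤ -2) : aC α i j k l = 0 := by
  simp only [aC, aC0]
  split_ifs <;> first | rfl | omega

theorem aC_eq_zero_of_le_left {F : Type*} [Field F] (α : F) (i k : ℤ) {j l : ℤ}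
    (hj : j ≤ -2) (hjl : -1 ≤ j + l) : aC α i j k l = 0 := by
  simp only [aC, aC0]
  split_ifs <;> first | simp; done | omega

theorem aC_eq_zero_of_le_right {F : Type*} [Field F] (α : F) (i k : ℤ) {j l : ℤ}
    (hl : l ≤ -2) (hjl : -1 ≤ j + l) : aC α i j k l = 0 := by
  simp only [aC, aC0]
  split_ifs <;> first | rfl | omega

theorem aC_of_neg_one_le {F : Type*} [Field F] (α : F) (i k : ℤ) {j l : ℤ}
    (hj : -1 ≤ j) (hl : -1 ≤ l) (hjl : -1 ≤ j + l) :
    aC α i j k l = (k : F) * (j + 1) - (l + 1) * i + (l - j) * α := by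
  simp only [aC, aC0, if_pos (Or.inl hj : -1 ≤ j ∨ l ≤ -2),
    if_pos (⟨hj, hl, hjl⟩ : -1 ≤ j ∧ -1 ≤ l ∧ -1 ≤ j + l)]
  push_cast
  ring

theorem cC_mem_Cminus {F : Type*} [Field F] (α : F) {p q : ℤ × ℤ}
    (h : p.2 ≤ -2 ∨ q.2 ≤ -2) : cC α p q ∈ Cminus F := by
  by_cases hs : (p + q).2 ≤ -2
  · exact single_mem_Cminus hs _
  · have hs' : -1 ≤ p.2 + q.2 := by rw [Prod.snd_add] at hs; omega
    have h0 : aC α p.1 p.2 q.1 q.2 = 0 := h.elim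
      (fun hp => aC_eq_zero_of_le_left α _ _ hp hs')
      (fun hq => aC_eq_zero_of_le_right α _ _ hq hs')
    simp [cC, h0]

theorem brkt_mem_Cminus_left {F : Type*} [Field F] (α : F) {x : (ℤ × ℤ) →₀ F}
    (hx : x ∈ Cminus F) (y : (ℤ × ℤ) →₀ F) : brkt (cC α) x y ∈ Cminus F := by
  rw [← brktBilin_apply]
  induction hx using Submodule.span_induction with
  | mem x hx =>
    obtain ⟨p, hp, rfl⟩ := hx
    induction y using Finsupp.induction_linear with
    | zero => simp
    | add y z hy hz => rw [map_add]; exact add_mem hy hz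
    | single q b =>
      rw [brktBilin_single]
      exact Submodule.smul_mem _ _ (cC_mem_Cminus α (Or.inl hp))
  | zero => simp
  | add x z _ _ hx hz => rw [map_add]; exact add_mem hx hz
  | smul a x _ hx => rw [map_smul]; exact Submodule.smul_mem _ a hx

theorem brkt_mem_Cminus_right {F : Type*} [Field F] (α : F) {x : (ℤ × ℤ) →₀ F}
    (hx : x ∈ Cminus F) (y : (ℤ × ℤ) →₀ F) : brkt (cC α) y x ∈ Cminus F := by
  rw [← brktBilin_apply]
  induction hx using Submodule.span_induction with
  | mem x hx =>
    obtain ⟨p, hp, rfl⟩ := hx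
    induction y using Finsupp.induction_linear with
    | zero => simp
    | add y z hy hz => rw [map_add]; exact add_mem hy hz
    | single q b =>
      rw [brktBilin_single]
      exact Submodule.smul_mem _ _ (cC_mem_Cminus α (Or.inr hp))
  | zero => simp
  | add x z _ _ hx hz => rw [map_add]; exact add_mem hx hz
  | smul a x _ hx => rw [map_smul]; exact Submodule.smul_mem _ a hx

theorem brkt_eq_zero_of_mem_Cminus {F : Type*} [Field F] (α : F) {x y : (ℤ × ℤ) →₀ F}
    (hx : x ∈ Cminus F) (hy : y ∈ Cminus F) : brkt (cC α) x y = 0 := by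
  rw [← brktBilin_apply]
  induction hx, hy using Submodule.span_induction₂ with
  | mem_mem x y hx hy =>
    obtain ⟨p, hp, rfl⟩ := hx
    obtain ⟨q, hq, rfl⟩ := hy
    simp [brktBilin_single, cC, aC_eq_zero_of_le_of_le α p.1 q.1 hp hq]
  | zero_left => simp
  | zero_right => simp
  | add_left x y z _ _ _ hx hy => simp [hx, hy]
  | add_right x y z _ _ _ hx hy => simp [hx, hy]
  | smul_left a x y _ _ h => simp [h]
  | smul_right a x y _ _ h => simp [h]

theorem inl_mem_BpIdx_iff {F : Type*} [Field F] [CharZero F] {α : F} {p : ℤ × ℤ} :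
    (Sum.inl p : (ℤ × ℤ) ⊕ Unit) ∈ BpIdx (-α) ↔ -1 ≤ p.2 ∧ ¬((p.1 : F) = α ∧ p.2 = -1) := by
  have h1 : ((p.2 : F) = -1) ↔ p.2 = -1 := by exact_mod_cast Iff.rfl
  have h2 : ((p.2 : F) = -2) ↔ p.2 = -2 := by exact_mod_cast Iff.rfl
  simp only [BpIdx, Set.mem_ofPred_eq, Sum.elim_inl, h1, h2, neg_neg]
  constructor
  · rintro ⟨⟨h, -⟩, h'⟩
    exact ⟨h', h⟩
  · rintro ⟨h', h⟩
    exact ⟨⟨h, fun h3 => by omega⟩, h'⟩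

theorem inr_mem_BpIdx_iff {F : Type*} [Field F] {α : F} :
    (Sum.inr () : (ℤ × ℤ) ⊕ Unit) ∈ BpIdx (-α) ↔ ∃ m : ℤ, (m : F) = α := by
  simp only [BpIdx, Set.mem_ofPred_eq, Sum.elim_inr, neg_neg]
  exact ⟨fun ⟨p, hp, _⟩ => ⟨p.1, hp⟩, fun ⟨m, hm⟩ => ⟨(m, -1), hm, by simp⟩⟩

open Classical in
/-- The images of the basis vectors under `C(α) → B⁺(−α,−1;1,0,0)`: `L_{i,j} ↦ -L_{i,j}` for
indices of `B⁺`, `L_{α,-1} ↦ c₁`, and `L_{i,j} ↦ 0` for `j ≤ -2`. -/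
noncomputable def toBpBasis {F : Type*} [Field F] (α : F) (p : ℤ × ℤ) : ↥(BpIdx (-α)) →₀ F :=
  if h : (Sum.inl p : (ℤ × ℤ) ⊕ Unit) ∈ BpIdx (-α) then Finsupp.single ⟨Sum.inl p, h⟩ (-1)
  else if h : p.2 = -1 ∧ (Sum.inr () : (ℤ × ℤ) ⊕ Unit) ∈ BpIdx (-α) then
    Finsupp.single ⟨Sum.inr (), h.2⟩ 1
  else 0

theorem toBpBasis_of_mem {F : Type*} [Field F] {α : F} {p : ℤ × ℤ}
    (h : (Sum.inl p : (ℤ × ℤ) ⊕ Unit) ∈ BpIdx (-α)) :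
    toBpBasis α p = Finsupp.single ⟨Sum.inl p, h⟩ (-1) :=
  dif_pos h

theorem toBpBasis_central {F : Type*} [Field F] [CharZero F] {α : F} {p : ℤ × ℤ}
    (h₁ : (p.1 : F) = α) (h₂ : p.2 = -1) :
    toBpBasis α p = Finsupp.single ⟨Sum.inr (), inr_mem_BpIdx_iff.2 ⟨p.1, h₁⟩⟩ 1 := by
  rw [toBpBasis, dif_neg fun h => (inl_mem_BpIdx_iff.1 h).2 ⟨h₁, h₂⟩,
    dif_pos ⟨h₂, inr_mem_BpIdx_iff.2 ⟨p.1, h₁⟩⟩]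

theorem toBpBasis_of_le {F : Type*} [Field F] [CharZero F] (α : F) {p : ℤ × ℤ}
    (h : p.2 ≤ -2) : toBpBasis α p = 0 := by
  rw [toBpBasis, dif_neg fun h' => ?_, dif_neg fun h' => ?_]
  · omega
  · have := (inl_mem_BpIdx_iff.1 h').1
    omega

/-- The linear map `C(α) → B⁺(−α,−1;1,0,0)` with kernel `C⁻(α)`. -/
noncomputable def toBp {F : Type*} [Field F] (α : F) :
    ((ℤ × ℤ) →₀ F) →ₗ[F] (↥(BpIdx (-α)) →₀ F) :=
  Finsupp.linearCombination F (toBpBasis α)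

theorem toBp_single {F : Type*} [Field F] (α : F) (p : ℤ × ℤ) (a : F) :
    toBp α (Finsupp.single p a) = a • toBpBasis α p := by
  simp [toBp]

theorem toBp_eq_zero_of_mem {F : Type*} [Field F] [CharZero F] (α : F) {x : (ℤ × ℤ) →₀ F}
    (hx : x ∈ Cminus F) : toBp α x = 0 := by
  suffices h : Cminus F ≤ LinearMap.ker (toBp α) from h hx
  refine Submodule.span_le.2 ?_
  rintro _ ⟨p, hp, rfl⟩
  simp [toBp_single, toBpBasis_of_le α hp]

theorem exists_section_toBp {F : Type*} [Field F] [CharZero F] (α : F) :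
    ∃ ψ : (↥(BpIdx (-α)) →₀ F) →ₗ[F] ((ℤ × ℤ) →₀ F),
      (∀ y, toBp α (ψ y) = y) ∧ ∀ x, x - ψ (toBp α x) ∈ Cminus F := by
  let s : ↥(BpIdx (-α)) → ((ℤ × ℤ) →₀ F) := fun x => match x with
    | ⟨Sum.inl p, _⟩ => Finsupp.single p (-1)
    | ⟨Sum.inr (), h⟩ => Finsupp.single ((inr_mem_BpIdx_iff.1 h).choose, -1) 1
  refine ⟨Finsupp.linearCombination F s, fun y => ?_, fun x => ?_⟩
  · induction y using Finsupp.induction_linear with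
    | zero => simp
    | add y z hy hz => simp [hy, hz]
    | single i a =>
      obtain ⟨p | ⟨⟩, h⟩ := i
      · simp [s, toBp_single, toBpBasis_of_mem h]
      · have hc := toBpBasis_central (p := ((inr_mem_BpIdx_iff.1 h).choose, -1))
          (inr_mem_BpIdx_iff.1 h).choose_spec rfl
        rw [Finsupp.linearCombination_single, map_smul, toBp_single, hc]
        simp
  · induction x using Finsupp.induction_linear with
    | zero => simp
    | add y z hy hz =>
      rw [map_add, map_add, add_sub_add_comm]
      exact add_mem hy hz
    | single p a =>
      rcases le_or_gt p.2 (-2) with hp | hp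
      · simpa [toBp_single, toBpBasis_of_le α hp] using single_mem_Cminus hp a
      · by_cases hc : (p.1 : F) = α ∧ p.2 = -1
        · have hm := (inr_mem_BpIdx_iff.1 (inr_mem_BpIdx_iff.2 ⟨p.1, hc.1⟩)).choose_spec
          have hp' : ((inr_mem_BpIdx_iff.1 (inr_mem_BpIdx_iff.2 ⟨p.1, hc.1⟩)).choose, -1) = p :=
            Prod.ext (Int.cast_injective (hm.trans hc.1.symm)) hc.2.symm
          simp [toBp_single, toBpBasis_central hc.1 hc.2, s, hp']
        · have h := inl_mem_BpIdx_iff.2 ⟨by omega, hc⟩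
          simp [toBp_single, toBpBasis_of_mem h, s]

theorem toBp_cC {F : Type*} [Field F] [CharZero F] (α : F) (p q : ℤ × ℤ) :
    toBp α (cC α p q) = brktBilin (cBp (-α)) (toBpBasis α p) (toBpBasis α q) := by
  rcases le_or_gt p.2 (-2) with hp | hp
  · simp [toBpBasis_of_le α hp, toBp_eq_zero_of_mem α (cC_mem_Cminus α (Or.inl hp))]
  rcases le_or_gt q.2 (-2) with hq | hq
  · simp [toBpBasis_of_le α hq, toBp_eq_zero_of_mem α (cC_mem_Cminus α (Or.inr hq))]
  rw [cC, toBp_single]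
  by_cases hpc : (p.1 : F) = α ∧ p.2 = -1
  · have hR : ∀ v, brktBilin (cBp (-α)) (toBpBasis α p) v = 0 := fun v => by
      rw [toBpBasis_central hpc.1 hpc.2]
      induction v using Finsupp.induction_linear with
      | zero => simp
      | add y z hy hz => simp [hy, hz]
      | single i a => simp [brktBilin_single, cBp]
    rw [hR]
    rcases le_or_gt (p + q).2 (-2) with hs | hs
    · rw [toBpBasis_of_le α hs, smul_zero]
    · rw [Prod.snd_add] at hs
      rw [aC_of_neg_one_le α _ _ (by omega) (by omega) (by omega), hpc.1, hpc.2]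
      convert zero_smul F _
      push_cast
      ring
  by_cases hqc : (q.1 : F) = α ∧ q.2 = -1
  · have hR : ∀ v, brktBilin (cBp (-α)) v (toBpBasis α q) = 0 := fun v => by
      rw [toBpBasis_central hqc.1 hqc.2]
      induction v using Finsupp.induction_linear with
      | zero => simp
      | add y z hy hz => simp [hy, hz]
      | single i a => obtain ⟨_ | _, _⟩ := i <;> simp [brktBilin_single, cBp]
    rw [hR]
    rcases le_or_gt (p + q).2 (-2) with hs | hs
    · rw [toBpBasis_of_le α hs, smul_zero]
    · rw [Prod.snd_add] at hs
      rw [aC_of_neg_one_le α _ _ (by omega) (by omega) (by omega), hqc.1, hqc.2]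
      convert zero_smul F _
      push_cast
      ring
  have hcond : (((p.1 + q.1 : ℤ) : F) = - -α ∧ ((p.2 + q.2 : ℤ) : F) = -1) ↔
      (((p + q).1 : F) = α ∧ (p + q).2 = -1) := by
    rw [neg_neg, Prod.fst_add, Prod.snd_add]
    exact and_congr_right' (by exact_mod_cast Iff.rfl)
  rw [toBpBasis_of_mem (inl_mem_BpIdx_iff.2 ⟨by omega, hpc⟩),
    toBpBasis_of_mem (inl_mem_BpIdx_iff.2 ⟨by omega, hqc⟩), brktBilin_single]
  simp only [cBp, neg_mul_neg, one_mul, one_smul]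
  rcases le_or_gt (p + q).2 (-2) with hs | hs
  · rw [toBpBasis_of_le α hs, dif_neg fun h => by have := (inl_mem_BpIdx_iff.1 h).1; omega,
      if_neg fun h => by have := (hcond.1 h).2; omega]
    simp
  have hs' : -1 ≤ p.2 + q.2 := by rw [Prod.snd_add] at hs; omega
  rw [aC_of_neg_one_le α _ _ (by omega) (by omega) hs']
  by_cases hsc : ((p + q).1 : F) = α ∧ (p + q).2 = -1
  · rw [toBpBasis_central hsc.1 hsc.2, dif_neg fun h => (inl_mem_BpIdx_iff.1 h).2 hsc,
      dif_pos (inr_mem_BpIdx_iff.2 ⟨_, hsc.1⟩), if_pos (hcond.2 hsc), zero_add, Finsupp.smul_single]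
    congr 1
    obtain ⟨h1, h2⟩ := hsc
    rw [Prod.fst_add] at h1
    rw [Prod.snd_add] at h2
    have h2' : (p.2 : F) + q.2 = -1 := by exact_mod_cast h2
    push_cast at h1
    have hq1 : (q.1 : F) = α - p.1 := by rw [← h1]; ring
    have hq2 : (q.2 : F) = -1 - p.2 := by rw [← h2']; ring
    rw [hq1, hq2, smul_eq_mul]
    ring
  · have h := inl_mem_BpIdx_iff.2 ⟨by omega, hsc⟩
    rw [toBpBasis_of_mem h, dif_pos h, if_neg (mt hcond.1 hsc), Finsupp.smul_single]
    simp only [Finsupp.single_zero, dite_eq_ite, ite_self, add_zero]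
    congr 1
    rw [smul_eq_mul]
    ring

theorem toBp_brkt {F : Type*} [Field F] [CharZero F] (α : F) (x y : (ℤ × ℤ) →₀ F) :
    toBp α (brkt (cC α) x y) = brkt (cBp (-α)) (toBp α x) (toBp α y) := by
  rw [← brktBilin_apply, ← brktBilin_apply]
  induction x using Finsupp.induction_linear with
  | zero => simp
  | add x z hx hz => simp [hx, hz]
  | single p a =>
    induction y using Finsupp.induction_linear with
    | zero => simp
    | add y z hy hz => simp [hy, hz]
    | single q b =>
      rw [brktBilin_single, map_smul, toBp_cC, toBp_single, toBp_single, map_smul, map_smul,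
        LinearMap.smul_apply, smul_smul, mul_comm]

theorem stmt_9 {F : Type*} [Field F] [CharZero F] (α : F) (hα : α ≠ 0) :
    -- C⁻(α) is an ideal of C(α)
    (∀ x ∈ Cminus F, ∀ y : (ℤ × ℤ) →₀ F,
      brkt (cC α) x y ∈ Cminus F ∧ brkt (cC α) y x ∈ Cminus F) ∧
    -- C⁻(α) is abelian
    (∀ x ∈ Cminus F, ∀ y ∈ Cminus F, brkt (cC α) x y = 0) ∧
    -- and the quotient C(α)/C⁻(α) is isomorphic to B⁺(−α,−1;1,0,0)
    (∃ φ : ((ℤ × ℤ) →₀ F) →ₗ[F] (↥(BpIdx (-α)) →₀ F),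
      Function.Surjective φ ∧
      LinearMap.ker φ = Cminus F ∧
      ∀ x y : (ℤ × ℤ) →₀ F, φ (brkt (cC α) x y) = brkt (cBp (-α)) (φ x) (φ y)) := by
  refine ⟨fun x hx y => ⟨brkt_mem_Cminus_left α hx y, brkt_mem_Cminus_right α hx y⟩,
    fun x hx y hy => brkt_eq_zero_of_mem_Cminus α hx hy, toBp α, ?_, ?_, toBp_brkt α⟩
  · obtain ⟨ψ, hψ, -⟩ := exists_section_toBp α
    exact fun y => ⟨ψ y, hψ y⟩
  · obtain ⟨ψ, -, hψ⟩ := exists_section_toBp α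
    refine le_antisymm (fun x hx => ?_) fun x hx => toBp_eq_zero_of_mem α hx
    simpa [LinearMap.mem_ker.1 hx] using hψ x
end

section
/- If c : ℤ×ℤ → F satisfies equation (E), then either β₁ ∈ {β₋₁, −β₋₁, −1−β₋₁, −2−β₋₁}, or (β₁,β₋₁) ∈ {(1,0), (−3,0), (0,1), (0,−3)}. -/
/-- Equation (E): `c(0,0) = 2α` together with the relation
`(−α+i+β₋₁k)c(i+k,j) + (α+j+β₁k)c(i,j+k) = (i+j−k)c(i,j)` for all integers `i,j,k`
satisfying the stated side conditions. -/
def SatE {F : Type*} [Field F] (α β₁ βm : F) (c : ℤ × ℤ → F) : Prop :=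
  c (0, 0) = 2 * α ∧
  ∀ i j k : ℤ,
    ((((i : F) - α) * ((i : F) + (k : F) - α) ≠ 0 ∨ βm ∉ ({0, 1} : Set F)) ∧
     (((j : F) + α) * ((j : F) + (k : F) + α) ≠ 0 ∨ β₁ ∉ ({0, 1} : Set F))) →
    (-α + (i : F) + βm * (k : F)) * c (i + k, j) +
      (α + (j : F) + β₁ * (k : F)) * c (i, j + k) =
      ((i : F) + (j : F) - (k : F)) * c (i, j)

/-- Equation (E) with the four linear factors of the side conditions assumed nonzero, and with the
shifted indices named. -/
lemma SatE.relation {F : Type*} [Field F] {α β₁ βm : F} {c : ℤ × ℤ → F} (hc : SatE α β₁ βm c)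
    (i j k p q : ℤ) (hp : i + k = p) (hq : j + k = q)
    (hi : (i : F) - α ≠ 0) (hik : (p : F) - α ≠ 0)
    (hj : (j : F) + α ≠ 0) (hjk : (q : F) + α ≠ 0) :
    (-α + i + βm * k) * c (p, j) + (α + j + β₁ * k) * c (i, q) = ((i : F) + j - k) * c (i, j) := by
  subst hp hq
  push_cast at hik hjk
  exact hc.2 i j k ⟨Or.inl (mul_ne_zero hi hik), Or.inl (mul_ne_zero hj hjk)⟩

/-- The values of `c` on the diagonal `i + j = 0` satisfy a three-term relation of every step `k`. -/
lemma SatE.diagonal_relation {F : Type*} [Field F] {α β₁ βm : F} {c : ℤ × ℤ → F}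
    (hc : SatE α β₁ βm c) (i k : ℤ) {t : F} (ht : t = i - α)
    (h₀ : t ≠ 0) (hadd : t + k ≠ 0) (hsub : t - k ≠ 0) :
    (t + βm * k) * (t + β₁ * k) * c (i + k, -(i + k)) +
      (t - βm * k) * (t - β₁ * k) * c (i - k, -(i - k)) =
      (2 * t ^ 2 + (k : F) ^ 2 * (βm + β₁ - βm ^ 2 - β₁ ^ 2 + 2)) * c (i, -i) := by
  subst ht
  have hup := hc.relation i (-i) k (i + k) (-(i - k)) rfl (by ring) h₀
    (by push_cast; contrapose! hadd; linear_combination hadd)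
    (by push_cast; contrapose! h₀; linear_combination -h₀)
    (by push_cast; contrapose! hsub; linear_combination -hsub)
  have hleft := hc.relation (i + k) (-i) (-k) i (-(i + k)) (by ring) (by ring)
    (by push_cast; contrapose! hadd; linear_combination hadd) h₀
    (by push_cast; contrapose! h₀; linear_combination -h₀)
    (by push_cast; contrapose! hadd; linear_combination -hadd)
  have hright := hc.relation i (-(i - k)) (-k) (i - k) (-i) (by ring) (by ring) h₀
    (by push_cast; contrapose! hsub; linear_combination hsub)
    (by push_cast; contrapose! hsub; linear_combination -hsub)
    (by push_cast; contrapose! h₀; linear_combination -h₀)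
  push_cast at hup hleft hright
  linear_combination (-2 * (k : F)) * hup - (-α + i + βm * k) * hleft - (α - i + β₁ * k) * hright

/-- Descending from the line `i + j = 2` to the line `i + j = 1` gives a further three-term relation
on the diagonal. -/
lemma SatE.diagonal_relation_of_two {F : Type*} [Field F] {α β₁ βm : F} {c : ℤ × ℤ → F}
    (hc : SatE α β₁ βm c) (i : ℤ) {t : F} (ht : t = i - α)
    (h₀ : t ≠ 0) (hadd : t + 1 ≠ 0) (hsub : t - 1 ≠ 0) :
    (2 * (t + β₁ - 1) * (t + β₁) + 3 * (t + 2 * β₁ - 1)) * c (i + 1, -(i + 1)) +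
      4 * (t + 1 - βm) * (1 - t - β₁) * c (i, -i) +
      (2 * (t + 1 - βm) * (t - βm) - 3 * (t + 1 - 2 * βm)) * c (i - 1, -(i - 1)) = 0 := by
  subst ht
  have hdown := hc.relation (i + 1) (-(i - 1)) (-1) i (-i) (by ring) (by ring)
    (by push_cast; contrapose! hadd; linear_combination hadd) h₀
    (by push_cast; contrapose! hsub; linear_combination -hsub)
    (by push_cast; contrapose! h₀; linear_combination -h₀)
  have hleft := hc.relation i (-(i - 1)) (-1) (i - 1) (-i) (by ring) (by ring) h₀
    (by push_cast; contrapose! hsub; linear_combination hsub)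
    (by push_cast; contrapose! hsub; linear_combination -hsub)
    (by push_cast; contrapose! h₀; linear_combination -h₀)
  have hright := hc.relation (i + 1) (-i) (-1) i (-(i + 1)) (by ring) (by ring)
    (by push_cast; contrapose! hadd; linear_combination hadd) h₀
    (by push_cast; contrapose! h₀; linear_combination -h₀)
    (by push_cast; contrapose! hadd; linear_combination -hadd)
  have htwo := hc.relation (i + 1) (-(i - 1)) (-2) (i - 1) (-(i + 1)) (by ring) (by ring)
    (by push_cast; contrapose! hadd; linear_combination hadd)
    (by push_cast; contrapose! hsub; linear_combination hsub)
    (by push_cast; contrapose! hsub; linear_combination -hsub)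
    (by push_cast; contrapose! hadd; linear_combination -hadd)
  push_cast at hdown hleft hright htwo
  linear_combination 4 * hdown + 2 * (i - α + 1 - βm) * hleft + 2 * (1 - i + α - β₁) * hright -
    3 * htwo

/-- Reflecting both indices and negating `α` preserves the relations of (E), up to sign. -/
lemma SatE.reflect {F : Type*} [Field F] {α β₁ βm : F} {c : ℤ × ℤ → F} (hc : SatE α β₁ βm c) :
    SatE (-α) β₁ βm (fun p => -c (-p.1, -p.2)) := by
  refine ⟨by simpa using hc.1, fun i j k h => ?_⟩
  have h' := hc.2 (-i) (-j) (-k) ⟨h.1.imp_left fun h => ?_, h.2.imp_left fun h => ?_⟩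
  · push_cast at h'
    simp only [neg_add]
    linear_combination h'
  · push_cast
    contrapose! h
    linear_combination h
  · push_cast
    contrapose! h
    linear_combination h

/-- For `β₁ ≠ β₋₁` and `β₁ + β₋₁ ∉ {-1, -2}`, the three relations of step one determine both
neighbours of a nonzero diagonal value, and force a polynomial constraint on `β₁, β₋₁`. -/
lemma SatE.neighbours {F : Type*} [Field F] [CharZero F] {α β₁ βm : F} {c : ℤ × ℤ → F}
    (hc : SatE α β₁ βm c) (hne : β₁ ≠ βm) (hone : β₁ + βm + 1 ≠ 0) (htwo : β₁ + βm + 2 ≠ 0)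
    (i : ℤ) {t : F} (ht : t = i - α) (h₀ : t ≠ 0) (hadd : t + 1 ≠ 0) (hsub : t - 1 ≠ 0)
    {σ d E : F} (hσ : σ = β₁ + βm) (hd : d = (β₁ - βm) ^ 2)
    (hE : E = (d + 2 * σ - 3) * (σ + 2)) :
    (2 * t ^ 2 - E) * c (i + 1, -(i + 1)) =
        (2 * t ^ 2 - E + (σ + 2) * (1 + σ) - 2 * (1 + σ) * t) * c (i, -i) ∧
      (2 * t ^ 2 - E) * c (i - 1, -(i - 1)) =
        (2 * t ^ 2 - E + (σ + 2) * (1 + σ) + 2 * (1 + σ) * t) * c (i, -i) ∧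
      (c (i, -i) ≠ 0 → d * (3 - 2 * σ) = 3 * σ ^ 2 - 14 * σ + 12) := by
  have hR := hc.diagonal_relation i 1 ht h₀ (by simpa using hadd) (by simpa using hsub)
  have hP := hc.diagonal_relation_of_two i ht h₀ hadd hsub
  have hM := hc.reflect.diagonal_relation_of_two (-i) (t := -t) (by rw [ht]; push_cast; ring)
    (by simpa using h₀) (by contrapose! hsub; linear_combination -hsub)
    (by contrapose! hadd; linear_combination -hadd)
  simp only [show -(-i + 1) = i - 1 by ring, show -(-i - 1) = i + 1 by ring, neg_neg] at hM
  push_cast at hR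
  clear ht
  generalize c (i + 1, -(i + 1)) = x at *
  generalize c (i - 1, -(i - 1)) = z at *
  generalize c (i, -i) = y at *
  subst hσ
  have hD₁ : 2 * t * (x + z - 2 * y) = -((β₁ + βm) + 2) * (x - z) := by
    refine mul_left_cancel₀ (mul_ne_zero two_ne_zero (sub_ne_zero.2 hne)) ?_
    linear_combination hP + hM
  have hD₂ : t * (x - z) + (d + 2 * (β₁ + βm) - 3) * (x + z - 2 * y) +
      (2 + 2 * (β₁ + βm)) * y = 0 := by
    refine mul_left_cancel₀ (two_ne_zero (α := F)) ?_
    subst hd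
    linear_combination hP - hM - 4 * hR
  have hv : (2 * t ^ 2 - E) * (x - z) = -4 * (1 + (β₁ + βm)) * t * y := by
    subst hE
    linear_combination 2 * t * hD₂ - (d + 2 * (β₁ + βm) - 3) * hD₁
  have hw : (2 * t ^ 2 - E) * (x + z - 2 * y) =
      2 * ((β₁ + βm) + 2) * (1 + (β₁ + βm)) * y := by
    refine mul_left_cancel₀ (mul_ne_zero two_ne_zero h₀) ?_
    linear_combination (2 * t ^ 2 - E) * hD₁ - (β₁ + βm + 2) * hv
  refine ⟨?_, ?_, fun hy => ?_⟩
  · linear_combination (hw + hv) / 2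
  · linear_combination (hw - hv) / 2
  · have hxz : x - z ≠ 0 := fun h => by
      rw [h, mul_zero] at hv
      have : -4 * (1 + (β₁ + βm)) * t * y ≠ 0 :=
        mul_ne_zero (mul_ne_zero (mul_ne_zero (by norm_num) (by rwa [add_comm])) h₀) hy
      exact this hv.symm
    have hprod : (x - z) * ((β₁ + βm + 2) *
        (d * (3 - 2 * (β₁ + βm)) - (3 * (β₁ + βm) ^ 2 - 14 * (β₁ + βm) + 12))) = 0 := by
      subst hE hd
      linear_combination (-2 * (2 - (β₁ + βm))) * hv - 8 * t * hR + 4 * (t ^ 2 + βm * β₁) * hD₁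
    exact sub_eq_zero.1 (((mul_eq_zero.1 hprod).resolve_left hxz |> mul_eq_zero.1).resolve_left htwo)

/-- Outside the listed parameters, the diagonal values vanish away from the indices near `α`. -/
lemma SatE.diagonal_eq_zero {F : Type*} [Field F] [CharZero F] {α β₁ βm : F} {c : ℤ × ℤ → F}
    (hc : SatE α β₁ βm c) (hne : β₁ ≠ βm) (hzero : β₁ + βm ≠ 0) (hone : β₁ + βm + 1 ≠ 0)
    (htwo : β₁ + βm + 2 ≠ 0) (hleft : ¬(β₁ = -3 ∧ βm = 0)) (hright : ¬(β₁ = 0 ∧ βm = -3))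
    (i : ℤ) {t : F} (ht : t = i - α) (h₀ : t ≠ 0) (hadd : t + 1 ≠ 0) (hsub : t - 1 ≠ 0)
    (hadd₂ : t + 2 ≠ 0) : c (i, -i) = 0 := by
  by_contra hy
  obtain ⟨σ, hσ⟩ : ∃ σ, σ = β₁ + βm := ⟨_, rfl⟩
  obtain ⟨d, hd⟩ : ∃ d, d = (β₁ - βm) ^ 2 := ⟨_, rfl⟩
  obtain ⟨E, hE⟩ : ∃ E, E = (d + 2 * σ - 3) * (σ + 2) := ⟨_, rfl⟩
  obtain ⟨hup, -, hK⟩ := hc.neighbours hne hone htwo i ht h₀ hadd hsub hσ hd hE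
  obtain ⟨-, hdown, -⟩ := hc.neighbours hne hone htwo (i + 1) (t := t + 1)
    (by rw [ht]; push_cast; ring) hadd (by contrapose! hadd₂; linear_combination hadd₂)
    (by simpa using h₀) hσ hd hE
  rw [add_sub_cancel_right] at hdown
  replace hK := hK hy
  rw [← hσ] at hzero hone htwo
  have hprod : c (i, -i) * ((σ + 1) * ((σ + 2) * ((σ + 3) * (8 - 3 * σ - 2 * d)))) = 0 := by
    subst hE
    linear_combination (-(2 * t ^ 2 - (d + 2 * σ - 3) * (σ + 2))) * hdown -
      (2 * (t + 1) ^ 2 - (d + 2 * σ - 3) * (σ + 2) + (σ + 2) * (1 + σ) +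
        2 * (1 + σ) * (t + 1)) * hup
  have h := (mul_eq_zero.1 hprod).resolve_left hy
  replace h := (mul_eq_zero.1 ((mul_eq_zero.1 h).resolve_left hone)).resolve_left htwo
  rcases mul_eq_zero.1 h with h | h
  · have hσ₃ : β₁ + βm = -3 := by linear_combination h - hσ
    have hd₉ : (β₁ - βm - 3) * (β₁ - βm + 3) = 0 := by
      have h9 : d * 9 = 81 := by
        rw [hσ, hσ₃] at hK
        linear_combination hK
      linear_combination h9 / 9 - hd
    rcases mul_eq_zero.1 hd₉ with h' | h'
    · exact hright ⟨by linear_combination (hσ₃ + h') / 2, by linear_combination (hσ₃ - h') / 2⟩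
    · exact hleft ⟨by linear_combination (hσ₃ + h') / 2, by linear_combination (hσ₃ - h') / 2⟩
  · refine hzero ?_
    linear_combination (2 * hK + (3 - 2 * σ) * h) / 3

lemma eventually_mul_natCast_ne {F : Type*} [Field F] [CharZero F] {a : F} (ha : a ≠ 0) (e : F) :
    ∀ᶠ n : ℕ in Filter.atTop, e * n ≠ a := by
  by_cases h : ∃ n₀ : ℕ, e * n₀ = a
  · obtain ⟨n₀, rfl⟩ := h
    filter_upwards [Filter.eventually_gt_atTop n₀] with n hn heq
    exact hn.ne' (Nat.cast_injective (mul_left_cancel₀ (left_ne_zero_of_mul ha) heq))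
  · push Not at h
    exact Filter.Eventually.of_forall h

theorem stmt_10 {F : Type*} [Field F] [CharZero F] (α : F) (hα : α ≠ 0)
    (β₁ βm : F) (c : ℤ × ℤ → F) (hc : SatE α β₁ βm c) :
    (β₁ = βm ∨ β₁ = -βm ∨ β₁ = -1 - βm ∨ β₁ = -2 - βm) ∨
    ((β₁ = 1 ∧ βm = 0) ∨ (β₁ = -3 ∧ βm = 0) ∨ (β₁ = 0 ∧ βm = 1) ∨ (β₁ = 0 ∧ βm = -3)) := by
  by_contra hcon
  obtain ⟨⟨hne, hzero, hone, htwo⟩, -, hleft, -, hright⟩ :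
      (β₁ ≠ βm ∧ β₁ ≠ -βm ∧ β₁ ≠ -1 - βm ∧ β₁ ≠ -2 - βm) ∧
      (¬(β₁ = 1 ∧ βm = 0) ∧ ¬(β₁ = -3 ∧ βm = 0) ∧ ¬(β₁ = 0 ∧ βm = 1) ∧
        ¬(β₁ = 0 ∧ βm = -3)) := by
    simpa only [not_or] using hcon
  have hvanish (i : ℤ) := hc.diagonal_eq_zero hne
    (by contrapose! hzero; linear_combination hzero)
    (by contrapose! hone; linear_combination hone)
    (by contrapose! htwo; linear_combination htwo) hleft hright i rfl
  obtain ⟨N, hN⟩ := Filter.eventually_atTop.1 (eventually_mul_natCast_ne hα 1)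
  obtain ⟨n, hm, hb, hn⟩ := ((eventually_mul_natCast_ne hα (1 - βm)).and
    ((eventually_mul_natCast_ne hα (1 - β₁)).and (Filter.eventually_ge_atTop (N + 1)))).exists
  have hfar (l : ℕ) (hl : N ≤ l) : (l : F) - α ≠ 0 := sub_ne_zero.2 (by simpa using hN l hl)
  have hzero_of_le (l : ℕ) (hl : N + 1 ≤ l) : c ((l : ℤ), -(l : ℤ)) = 0 := by
    obtain ⟨l, rfl⟩ : ∃ l', l = l' + 1 := ⟨l - 1, by omega⟩
    have h₀ := hfar l (by omega)
    have h₁ := hfar (l + 1) (by omega)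
    have h₂ := hfar (l + 2) (by omega)
    have h₃ := hfar (l + 3) (by omega)
    push_cast at h₁ h₂ h₃
    refine hvanish _ ?_ ?_ ?_ ?_ <;> push_cast
    · exact h₁
    · contrapose! h₂; linear_combination h₂
    · contrapose! h₀; linear_combination h₀
    · contrapose! h₃; linear_combination h₃
  have hrel := hc.diagonal_relation (n : ℤ) (n : ℤ) rfl
    (by simpa using hfar n (by omega))
    (by
      have := hfar (n + n) (by omega)
      push_cast at this ⊢
      contrapose! this; linear_combination this)
    (by simpa using hα)
  have hdouble := hzero_of_le (n + n) (by omega)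
  push_cast at hdouble
  rw [hzero_of_le n hn, hdouble, sub_self, neg_zero, hc.1] at hrel
  push_cast at hrel
  have hprod : ((1 - βm) * (n : F) - α) * ((1 - β₁) * n - α) * (2 * α) = 0 := by
    linear_combination hrel
  exact mul_ne_zero (mul_ne_zero (sub_ne_zero.2 hm) (sub_ne_zero.2 hb))
    (mul_ne_zero two_ne_zero hα) hprod
end

section
/- If β₁ = β₋₁ and some c : ℤ×ℤ → F satisfies equation (E), then β₁ ∈ {0, 1, −1, −1/2}. -/
open Polynomial Matrix in
/-- A matrix of polynomials that is injective at `0` is injective at `u / k` for some nonzero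
integer `k`. -/
theorem exists_int_injective_eval_div {F ι κ : Type*} [Field F] [CharZero F] [Fintype ι]
    [Fintype κ] (M : Matrix ι κ F[X])
    (hM : ∀ y : κ → F, M.map (eval 0) *ᵥ y = 0 → y = 0) (u : F) :
    ∃ k : ℤ, k ≠ 0 ∧ ∀ y : κ → F, M.map (eval (u / k)) *ᵥ y = 0 → y = 0 := by
  classical
  obtain ⟨g, hg⟩ := (M.map (eval 0)).toLin'.exists_leftInverse_of_injective
    (LinearMap.ker_eq_bot'.2 fun y hy => hM y (by simpa using hy))
  set L := LinearMap.toMatrix' g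
  have hL : L * M.map (eval 0) = 1 := by
    have := congrArg LinearMap.toMatrix' hg
    rwa [LinearMap.toMatrix'_comp, LinearMap.toMatrix'_toLin', LinearMap.toMatrix'_id] at this
  set N : Matrix κ κ F[X] := L.map C * M
  have hN (a : F) : N.map (eval a) = L * M.map (eval a) := by
    ext i j
    simp [N, Matrix.mul_apply, eval_finsetSum]
  have hdet (a : F) : N.det.eval a = (L * M.map (eval a)).det := by
    rw [← hN, ← coe_evalRingHom, RingHom.map_det]
    rfl
  have hne : N.det ≠ 0 := fun h => by
    have := hdet 0
    simp [h, hL] at this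
  obtain ⟨k, hk, hku⟩ : ∃ k : ℤ, k ≠ 0 ∧ N.det.eval (u / k) ≠ 0 := by
    rcases eq_or_ne u 0 with rfl | hu
    · exact ⟨1, one_ne_zero, by simp [hdet, hL]⟩
    by_contra! h
    refine hne (eq_zero_of_infinite_isRoot _ ?_)
    refine Set.Infinite.mono (s := (fun k : ℤ => u / k) '' {0}ᶜ) ?_ ?_
    · rintro _ ⟨k, hk, rfl⟩
      exact h k hk
    · refine (Set.Infinite.image ?_ (Set.finite_singleton 0).infinite_compl)
      intro a _ b _ hab
      simpa [div_eq_mul_inv, hu] using hab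
  refine ⟨k, hk, fun y hy => ?_⟩
  rw [hdet] at hku
  refine Matrix.mulVec_injective_of_det_ne_zero hku ?_
  rw [← Matrix.mulVec_mulVec, hy, Matrix.mulVec_zero, Matrix.mulVec_zero]

/-- Elimination of the lines `i + j ≠ 0` between the relations with shifts `±m * k`. -/
theorem SatE.three_term {F : Type*} [Field F] [CharZero F] {b t : F} {k : ℤ} (hk : k ≠ 0)
    {c : ℤ × ℤ → F}
    (h : ∀ i j l : ℤ, (t * k + i + b * l) * c (i + l, j) + (-(t * k) + j + b * l) * c (i, j + l)
      = (i + j - l) * c (i, j)) (s m : ℤ) :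
    (t + s + b * m) ^ 2 * c ((s + m) * k, -((s + m) * k))
      + (t + s - b * m) ^ 2 * c ((s - m) * k, -((s - m) * k))
      = (2 * (t + s) ^ 2 + 2 * (1 + b - b ^ 2) * m ^ 2) * c (s * k, -(s * k)) := by
  have hk' : (k : F) ^ 2 ≠ 0 := by exact_mod_cast pow_ne_zero 2 hk
  have h₁ := h (s * k) (-(s * k)) (m * k)
  have h₂ := h ((s + m) * k) (-(s * k)) (-(m * k))
  have h₃ := h (s * k) (-((s - m) * k)) (-(m * k))
  rw [show s * k + m * k = (s + m) * k by ring,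
    show -(s * k) + m * k = -((s - m) * k) by ring] at h₁
  rw [show (s + m) * k + -(m * k) = s * k by ring,
    show -(s * k) + -(m * k) = -((s + m) * k) by ring] at h₂
  rw [show s * k + -(m * k) = (s - m) * k by ring,
    show -((s - m) * k) + -(m * k) = -(s * k) by ring] at h₃
  push_cast at h₁ h₂ h₃
  apply mul_left_cancel₀ hk'
  linear_combination (-2 * m * k) * h₁ - (t + s + b * m) * k * h₂ - (-t - s + b * m) * k * h₃

/-- Elimination of the lines `i + j ≠ 0` from the relation between the lines `k` and `2 * k`. -/
theorem SatE.four_term {F : Type*} [Field F] [CharZero F] {b t : F} {k : ℤ} (hk : k ≠ 0)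
    {c : ℤ × ℤ → F}
    (h : ∀ i j l : ℤ, (t * k + i + b * l) * c (i + l, j) + (-(t * k) + j + b * l) * c (i, j + l)
      = (i + j - l) * c (i, j)) (s : ℤ) :
    (t + s + b) * ((t + s + 1 - 2 * b) * c ((s - 1) * k, -((s - 1) * k))
        + (1 - t - s - 2 * b) * c ((s + 1) * k, -((s + 1) * k)))
      + (1 - t - s + b) * ((t + s - 2 * b) * c ((s - 2) * k, -((s - 2) * k))
        + (2 - t - s - 2 * b) * c (s * k, -(s * k))) = 0 := by
  have hk' : (k : F) ^ 2 ≠ 0 := by exact_mod_cast pow_ne_zero 2 hk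
  have h₁ := h (s * k) (-((s - 1) * k)) k
  have h₂ := h ((s + 1) * k) (-((s - 1) * k)) (-(2 * k))
  have h₃ := h (s * k) (-((s - 2) * k)) (-(2 * k))
  rw [show s * k + k = (s + 1) * k by ring,
    show -((s - 1) * k) + k = -((s - 2) * k) by ring] at h₁
  rw [show (s + 1) * k + -(2 * k) = (s - 1) * k by ring,
    show -((s - 1) * k) + -(2 * k) = -((s + 1) * k) by ring] at h₂
  rw [show s * k + -(2 * k) = (s - 2) * k by ring,
    show -((s - 2) * k) + -(2 * k) = -(s * k) by ring] at h₃
  push_cast at h₁ h₂ h₃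
  apply mul_left_cancel₀ hk'
  linear_combination (4 * k) * h₁ + (t + s + b) * k * h₂ + (1 - t - s + b) * k * h₃

open Polynomial in
/-- The coefficients, as polynomials in `t`, of some of the three-term and four-term relations
among the seven values `c (s * k, -(s * k))` with `-3 ≤ s ≤ 3`. -/
noncomputable def relationMatrix {F : Type*} [Field F] (b : F) : Matrix (Fin 11) (Fin 7) F[X] :=
  let p (s m : F) : F[X] := (X + C (s + b * m)) ^ 2
  let q (s m : F) : F[X] := -(2 * (X + C s) ^ 2 + C (2 * (1 + b - b ^ 2) * m ^ 2))
  let f (s : F) : F[X] := (X + C (s + b)) * (X + C (s + 1 - 2 * b))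
  let g (s : F) : F[X] := (X + C (s + b)) * (C (1 - s - 2 * b) - X)
  let f₂ (s : F) : F[X] := (C (1 - s + b) - X) * (X + C (s - 2 * b))
  let g₂ (s : F) : F[X] := (C (1 - s + b) - X) * (C (2 - s - 2 * b) - X)
  !![0, 0, p 0 (-1), q 0 1, p 0 1, 0, 0;
    0, p 0 (-2), 0, q 0 2, 0, p 0 2, 0;
    p 0 (-3), 0, 0, q 0 3, 0, 0, p 0 3;
    0, 0, 0, p 1 (-1), q 1 1, p 1 1, 0;
    0, p (-1) (-1), q (-1) 1, p (-1) 1, 0, 0, 0;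
    0, 0, 0, 0, p 2 (-1), q 2 1, p 2 1;
    p (-2) (-1), q (-2) 1, p (-2) 1, 0, 0, 0, 0;
    0, 0, p 1 (-2), 0, q 1 2, 0, p 1 2;
    p (-1) (-2), 0, q (-1) 2, 0, p (-1) 2, 0, 0;
    0, f₂ 0, f 0, g₂ 0, g 0, 0, 0;
    0, 0, f₂ 1, f 1, g₂ 1, g 1, 0]

open Polynomial Matrix in
theorem relationMatrix_mulVec_eq_zero {F : Type*} [Field F] [CharZero F] {b t : F} {k : ℤ}
    (hk : k ≠ 0) {c : ℤ × ℤ → F}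
    (h : ∀ i j l : ℤ, (t * k + i + b * l) * c (i + l, j) + (-(t * k) + j + b * l) * c (i, j + l)
      = (i + j - l) * c (i, j)) :
    (relationMatrix b).map (eval t) *ᵥ
      (fun s => c (((s : ℤ) - 3) * k, -(((s : ℤ) - 3) * k))) = 0 := by
  have three := SatE.three_term hk h
  have four := SatE.four_term hk h
  have h₀ := three 0 1
  have h₁ := three 0 2
  have h₂ := three 0 3
  have h₃ := three 1 1
  have h₄ := three (-1) 1
  have h₅ := three 2 1
  have h₆ := three (-2) 1
  have h₇ := three 1 2
  have h₈ := three (-1) 2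
  have h₉ := four 0
  have h₁₀ := four 1
  norm_num at h₀ h₁ h₂ h₃ h₄ h₅ h₆ h₇ h₈ h₉ h₁₀
  ext r
  fin_cases r <;>
    simp [relationMatrix, Matrix.mulVec, dotProduct, Fin.sum_univ_succ]
  · linear_combination h₀
  · linear_combination h₁
  · linear_combination h₂
  · linear_combination h₃
  · linear_combination h₄
  · linear_combination h₅
  · linear_combination h₆
  · linear_combination h₇
  · linear_combination h₈
  · linear_combination h₉
  · linear_combination h₁₀

open Polynomial Matrix in
theorem relationMatrix_injective_at_zero {F : Type*} [Field F] [CharZero F] {b : F}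
    (hb₀ : b ≠ 0) (hb₁ : b ≠ 1) (hb₂ : b ≠ -1) (hb₃ : b ≠ -(1 / 2)) {y : Fin 7 → F}
    (hy : (relationMatrix b).map (eval 0) *ᵥ y = 0) : y = 0 := by
  have row (r) := congrFun hy r
  simp only [relationMatrix, Matrix.mulVec, dotProduct, Fin.sum_univ_succ] at row
  have h₀ := row 0
  have h₁ := row 1
  have h₂ := row 2
  have h₃ := row 3
  have h₄ := row 4
  have h₅ := row 5
  have h₆ := row 6
  have h₇ := row 7
  have h₈ := row 8
  have h₉ := row 9
  have h₁₀ := row 10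
  simp at h₀ h₁ h₂ h₃ h₄ h₅ h₆ h₇ h₈ h₉ h₁₀
  have n₁ : b - 1 ≠ 0 := sub_ne_zero.2 hb₁
  have n₂ : b + 1 ≠ 0 := fun h => hb₂ (by linear_combination h)
  have n₃ : 2 * b + 1 ≠ 0 := fun h => hb₃ (by linear_combination h / 2)
  have d₂ : y 5 - y 1 = 0 := by
    have : b * (b + 1) * (y 5 - y 1) = 0 := by linear_combination (h₉ - h₁₀) / 2
    simpa [hb₀, n₂] using this
  have d₁ : y 4 - y 2 = 0 := by
    have e₁ : (b - 2) * (b + 1) * (y 4 - y 2) = 0 := by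
      linear_combination (h₃ - h₄) / 2 - (1 + b) ^ 2 / 2 * d₂
    rcases eq_or_ne (b - 2) 0 with hb | hb
    · obtain rfl : b = 2 := by linear_combination hb
      linear_combination (16 * (h₇ - h₈) - 25 * (h₅ - h₆) - 150 * d₂) / (-48)
    · simpa [hb, n₂] using e₁
  have d₃ : y 6 - y 0 = 0 := by
    have : (2 * b + 1) ^ 2 * (y 6 - y 0) = 0 := by
      linear_combination (h₇ - h₈) + ((1 - 2 * b) ^ 2 + 2 + 8 * (1 + b - b ^ 2)) * d₁
    simpa [n₃] using this
  have s₁₂ : y 4 + y 2 = y 5 + y 1 := by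
    have : b ^ 2 * (y 4 + y 2 - y 5 - y 1) = 0 := by linear_combination h₀ - h₁ / 4
    have := (mul_eq_zero.1 this).resolve_left (pow_ne_zero 2 hb₀)
    linear_combination this
  have s₁₃ : y 4 + y 2 = y 6 + y 0 := by
    have : b ^ 2 * (y 4 + y 2 - y 6 - y 0) = 0 := by linear_combination h₀ - h₂ / 9
    have := (mul_eq_zero.1 this).resolve_left (pow_ne_zero 2 hb₀)
    linear_combination this
  have s₁ : y 4 + y 2 = 0 := by
    have : (2 * b + 1) * (b - 1) * (y 4 + y 2) = 0 := by
      linear_combination (h₅ + h₆) / 2 - (8 + 2 * (1 + b - b ^ 2)) / 2 * s₁₂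
        + (2 + b) ^ 2 / 2 * s₁₃
    simpa [n₁, n₃] using this
  have x₀ : y 3 = 0 := by
    have : (b - 1) ^ 2 * y 3 = 0 := by
      linear_combination (h₃ + h₄) / 2 + (1 + b) ^ 2 / 2 * (s₁₂ - s₁)
        + (1 + (1 + b - b ^ 2)) * s₁
    simpa [n₁] using this
  ext r
  fin_cases r
  · show y 0 = 0
    linear_combination (s₁ - s₁₃ - d₃) / 2
  · show y 1 = 0
    linear_combination (s₁ - s₁₂ - d₂) / 2
  · show y 2 = 0
    linear_combination (s₁ - d₁) / 2
  · exact x₀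
  · show y 4 = 0
    linear_combination (s₁ + d₁) / 2
  · show y 5 = 0
    linear_combination (s₁ - s₁₂ + d₂) / 2
  · show y 6 = 0
    linear_combination (s₁ - s₁₃ + d₃) / 2

theorem stmt_11 {F : Type*} [Field F] [CharZero F] (α : F) (hα : α ≠ 0)
    (β₁ βm : F) (hβ : β₁ = βm) (c : ℤ × ℤ → F) (hc : SatE α β₁ βm c) :
    β₁ = 0 ∨ β₁ = 1 ∨ β₁ = -1 ∨ β₁ = -(1 / 2) := by
  subst hβ
  by_contra! hb
  obtain ⟨hb₀, hb₁, hb₂, hb₃⟩ := hb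
  obtain ⟨hc₀, hc⟩ := hc
  obtain ⟨k, hk, hinj⟩ := exists_int_injective_eval_div (relationMatrix β₁)
    (fun y => relationMatrix_injective_at_zero hb₀ hb₁ hb₂ hb₃) (-α)
  set t : F := -α / k
  have htk : t * k = -α := div_mul_cancel₀ _ (by exact_mod_cast hk)
  have h (i j l : ℤ) : (t * k + i + β₁ * l) * c (i + l, j)
      + (-(t * k) + j + β₁ * l) * c (i, j + l) = (i + j - l) * c (i, j) := by
    have hβ : β₁ ∉ ({0, 1} : Set F) := by simp [hb₀, hb₁]
    simpa [htk] using hc i j l ⟨.inr hβ, .inr hβ⟩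
  have hy := congrFun (hinj (fun s => c (((s : ℤ) - 3) * k, -(((s : ℤ) - 3) * k)))
    (relationMatrix_mulVec_eq_zero hk h)) 3
  simp [hc₀, hα] at hy
end

section
/- If β₋₁ = −β₁ with β₁ ≠ 0 and some c : ℤ×ℤ → F satisfies equation (E), then β₁ = 1 or β₁ = −1. -/
open Polynomial in
/-- A nonzero polynomial over an integral domain of characteristic zero has an integer non-root. -/
theorem exists_int_eval_ne_zero {R : Type*} [CommRing R] [IsDomain R] [CharZero R]
    {p : R[X]} (hp : p ≠ 0) : ∃ k : ℤ, p.eval (k : R) ≠ 0 := by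
  by_contra! h
  refine hp (Polynomial.eq_zero_of_infinite_isRoot p ?_)
  refine (Set.infinite_range_of_injective (Int.cast_injective (α := R))).mono ?_
  rintro _ ⟨k, rfl⟩
  exact h k

/-- The antidiagonal values `f i = c (i, -i)` of a solution of (E) with `β₋₁ = -β₁ ∉ {0, 1, -1}`
satisfy a one-dimensional three-term relation for every step `k`. -/
theorem SatE.antidiagonal_relation {F : Type*} [Field F] {α β : F} {c : ℤ × ℤ → F}
    (hc : SatE α β (-β) c) (h0 : β ≠ 0) (h1 : β ≠ 1) (hm1 : β ≠ -1) (i k : ℤ) :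
    ((i - α) ^ 2 - β ^ 2 * k ^ 2) * (c (i + k, -(i + k)) + c (i - k, -(i - k))) =
      2 * ((i - α) ^ 2 + (1 - β ^ 2) * k ^ 2) * c (i, -i) := by
  have hβ : β ∉ ({0, 1} : Set F) := by simp [h0, h1]
  have hβ' : -β ∉ ({0, 1} : Set F) := by
    simpa [h0] using fun h : -β = 1 => hm1 (by rw [← h, neg_neg])
  have hE := fun i j k : ℤ => hc.2 i j k ⟨Or.inr hβ', Or.inr hβ⟩
  have e₁ := hE i (-i) k
  have e₂ := hE (i + k) (-i) (-k)
  have e₃ := hE i (-i + k) (-k)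
  rw [show i + k + -k = i by ring, show -i + -k = -(i + k) by ring] at e₂
  rw [show i + -k = i - k by ring, show -i + k + -k = -i by ring,
    show -i + k = -(i - k) by ring] at e₃
  rw [show -i + k = -(i - k) by ring] at e₁
  push_cast at e₁ e₂ e₃
  linear_combination (-2 * k : F) * e₁ - (i - α - β * k) * e₂ + (i - α - β * k) * e₃

/-- The coefficient of `f (i + 1)` (with `u = i - α`, `b = β ^ 2`) after eliminating
`f (i - 2)`, `f (i - 1)` and `f (i + 2)` from the relations with steps `1` and `2`. -/
def nextCoeff {R : Type*} [CommRing R] (b u : R) : R :=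
  (u ^ 2 - b) * (u ^ 2 - 4 * b) *
    (((u + 1) ^ 2 + 1 - b) * ((u - 1) ^ 2 - b) - ((u - 1) ^ 2 + 1 - b) * ((u + 1) ^ 2 - b))

/-- The coefficient of `f i` matching `nextCoeff`. -/
def selfCoeff {R : Type*} [CommRing R] (b u : R) : R :=
  2 * ((u ^ 2 - b) * (u ^ 2 + 2 - 4 * b) * ((u + 1) ^ 2 - b) * ((u - 1) ^ 2 - b)) -
    2 * ((u ^ 2 - 4 * b) * ((u - 1) ^ 2 + 1 - b) * ((u + 1) ^ 2 - b) * (u ^ 2 + 1 - b))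

/-- The factor annihilating `f i`, obtained by comparing the two expressions of the ratio
`f (i + 1) / f i`. -/
def annihilator {R : Type*} [CommRing R] (b u : R) : R :=
  nextCoeff b u * nextCoeff b (-(u + 1)) - selfCoeff b u * selfCoeff b (-(u + 1))

theorem map_annihilator {R S : Type*} [CommRing R] [CommRing S] (φ : R →+* S) (b u : R) :
    φ (annihilator b u) = annihilator (φ b) (φ u) := by
  simp [annihilator, nextCoeff, selfCoeff, map_ofNat]

theorem nextCoeff_mul_eq {F : Type*} [Field F] [CharZero F] {b u x₂ x₁ y z₁ z₂ : F}
    (h₀ : (u ^ 2 - b) * (z₁ + x₁) = 2 * (u ^ 2 + 1 - b) * y)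
    (hp : ((u + 1) ^ 2 - b) * (z₂ + y) = 2 * ((u + 1) ^ 2 + 1 - b) * z₁)
    (hm : ((u - 1) ^ 2 - b) * (y + x₂) = 2 * ((u - 1) ^ 2 + 1 - b) * x₁)
    (h₂ : (u ^ 2 - 4 * b) * (z₂ + x₂) = 2 * (u ^ 2 + 4 - 4 * b) * y) :
    nextCoeff b u * z₁ = selfCoeff b u * y := by
  unfold nextCoeff selfCoeff
  refine mul_left_cancel₀ (two_ne_zero (α := F)) ?_
  linear_combination
    (u ^ 2 - b) * ((u + 1) ^ 2 - b) * ((u - 1) ^ 2 - b) * h₂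
    - (u ^ 2 - b) * (u ^ 2 - 4 * b) * ((u - 1) ^ 2 - b) * hp
    - (u ^ 2 - b) * (u ^ 2 - 4 * b) * ((u + 1) ^ 2 - b) * hm
    - 2 * (u ^ 2 - 4 * b) * ((u - 1) ^ 2 + 1 - b) * ((u + 1) ^ 2 - b) * h₀

theorem annihilator_ne_zero {F : Type*} [Field F] [CharZero F] {b : F} (h0 : b ≠ 0)
    (h1 : b ≠ 1) : annihilator (Polynomial.C b) Polynomial.X ≠ 0 := by
  intro h
  have heval (x : F) : annihilator b x = 0 := by
    simpa [h] using (map_annihilator (Polynomial.evalRingHom x) (Polynomial.C b) Polynomial.X).symm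
  have hb : b - 1 ≠ 0 := sub_ne_zero.mpr h1
  have e₀ : 1 + 8 * b - 3 * b ^ 2 = 0 := by
    refine (mul_eq_zero.mp (?_ : (48 * b ^ 2 * (b - 1) ^ 2) * _ = 0)).resolve_left (by simp [h0, hb])
    have := heval 0
    simp only [annihilator, nextCoeff, selfCoeff] at this
    linear_combination this
  have e₁ : 36 - 89 * b + 32 * b ^ 2 - 3 * b ^ 3 = 0 := by
    refine (mul_eq_zero.mp (?_ : (48 * b * (b - 1) ^ 2) * _ = 0)).resolve_left (by simp [h0, hb])
    have := heval 1
    simp only [annihilator, nextCoeff, selfCoeff] at this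
    linear_combination this
  have e₂ : 26 * b = 44 := by linear_combination (b - 8) * e₀ - e₁
  have : (1005 : F) = 0 := by linear_combination 169 * e₀ + (3 * (13 * b + 22) / 2 - 52) * e₂
  norm_num at this

theorem stmt_13 {F : Type*} [Field F] [CharZero F] (α : F) (hα : α ≠ 0)
    (β₁ βm : F) (hβ : βm = -β₁) (hβ₁ : β₁ ≠ 0)
    (c : ℤ × ℤ → F) (hc : SatE α β₁ βm c) :
    β₁ = 1 ∨ β₁ = -1 := by
  subst hβ
  by_contra! hne
  obtain ⟨h1, hm1⟩ := hne
  have rel := hc.antidiagonal_relation hβ₁ h1 hm1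
  set f : ℤ → F := fun i => c (i, -i) with hf
  have hf0 : f 0 ≠ 0 := by simpa [hf, hc.1] using hα
  set b := β₁ ^ 2 with hb
  have hb0 : b ≠ 0 := pow_ne_zero 2 hβ₁
  have hb1 : b ≠ 1 := fun h => (sq_eq_sq_iff_eq_or_eq_neg.mp (h.trans (one_pow 2).symm)).elim h1 hm1
  replace rel (i k : ℤ) : ((i - α) ^ 2 - b * k ^ 2) * (f (i + k) + f (i - k)) =
      2 * ((i - α) ^ 2 + (1 - b) * k ^ 2) * f i := rel i k
  have next (i : ℤ) : nextCoeff b (i - α) * f (i + 1) = selfCoeff b (i - α) * f i := by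
    have h₀ := rel i 1
    have hp := rel (i + 1) 1
    have hm := rel (i - 1) 1
    have h₂ := rel i 2
    rw [show i + 1 + 1 = i + 2 by ring, show i + 1 - 1 = i by ring] at hp
    rw [show i - 1 - 1 = i - 2 by ring, show i - 1 + 1 = i by ring] at hm
    push_cast at h₀ hp hm h₂
    apply nextCoeff_mul_eq (x₂ := f (i - 2)) (x₁ := f (i - 1)) (z₂ := f (i + 2))
    · linear_combination h₀
    · linear_combination hp
    · linear_combination hm
    · linear_combination h₂
  have prev (i : ℤ) :
      nextCoeff b (-(i + 1 - α)) * f i = selfCoeff b (-(i + 1 - α)) * f (i + 1) := by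
    have h₀ := rel (i + 1) 1
    have hp := rel i 1
    have hm := rel (i + 2) 1
    have h₂ := rel (i + 1) 2
    rw [show i + 1 + 1 = i + 2 by ring, show i + 1 - 1 = i by ring] at h₀
    rw [show i + 2 + 1 = i + 3 by ring, show i + 2 - 1 = i + 1 by ring] at hm
    rw [show i + 1 + 2 = i + 3 by ring, show i + 1 - 2 = i - 1 by ring] at h₂
    push_cast at h₀ hp hm h₂
    apply nextCoeff_mul_eq (x₂ := f (i + 3)) (x₁ := f (i + 2)) (z₂ := f (i - 1))
    · linear_combination h₀
    · linear_combination hp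
    · linear_combination hm
    · linear_combination h₂
  have ann (i : ℤ) (hi : annihilator b (i - α) ≠ 0) : f i = 0 := by
    refine (mul_eq_zero.mp (?_ : annihilator b (i - α) * f i = 0)).resolve_left hi
    have hp := prev i
    rw [show (i : F) + 1 - α = i - α + 1 by ring] at hp
    unfold annihilator
    linear_combination nextCoeff b (i - α) * hp + selfCoeff b (-(i - α + 1)) * next i
  open Polynomial in
  obtain ⟨k, hk⟩ : ∃ k : ℤ, annihilator b (k - α) ≠ 0 ∧ annihilator b (-k - α) ≠ 0 ∧
      α ^ 2 + (1 - b) * k ^ 2 ≠ 0 := by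
    have hP := annihilator_ne_zero hb0 hb1
    have hP₁ : (annihilator (C b) X).comp (X - C α) ≠ 0 := by
      simpa [sub_eq_add_neg] using (comp_X_add_C_ne_zero_iff (t := -α)).mpr hP
    have hP₂ : ((annihilator (C b) X).comp (X - C α)).comp (-X) ≠ 0 := by
      intro h
      apply hP₁
      simpa [comp_assoc] using congrArg (fun p => p.comp (-X)) h
    have hP₃ : C (α ^ 2) + C (1 - b) * X ^ 2 ≠ 0 := by
      intro h
      simpa [hα] using congrArg (eval 0) h
    obtain ⟨k, hk⟩ := exists_int_eval_ne_zero (mul_ne_zero (mul_ne_zero hP₁ hP₂) hP₃)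
    have heval (x : F) : eval x (annihilator (C b) X) = annihilator b x := by
      simpa using map_annihilator (evalRingHom x) (C b) X
    refine ⟨k, ?_⟩
    simpa [eval_comp, heval, and_assoc] using hk
  obtain ⟨hk₁, hk₂, hk₃⟩ := hk
  have h := rel 0 k
  rw [zero_add, zero_sub, ann k hk₁, ann (-k) (by simpa using hk₂)] at h
  have h' : (2 * (α ^ 2 + (1 - b) * k ^ 2)) * f 0 = 0 := by
    push_cast at h
    linear_combination -h
  exact mul_ne_zero (mul_ne_zero two_ne_zero hk₃) hf0 h'
end

section
/- Let α, β₁ ∈ F and suppose d : ℤ×ℤ → F satisfies d(i,j)·(2α+(2−β₁)(i+j)+(2+β₁)k) = d(0,i+j)·(2α+3β₁i+(2−β₁)j+(2+β₁)k) for all i,j,k ∈ ℤ. If d(i,j) ≠ 0 for some (i,j) with i ≠ 0, then β₁ = −2 or β₁ = 1/2; moreover, if β₁ ≠ −2 then d(i,j) = d(0,i+j) for all i,j ∈ ℤ. -/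
theorem stmt_14 {F : Type*} [Field F] [CharZero F] (α β₁ : F) (d : ℤ × ℤ → F)
    (hd : ∀ i j k : ℤ,
      d (i, j) * (2 * α + (2 - β₁) * ((i : F) + (j : F)) + (2 + β₁) * (k : F)) =
      d (0, i + j) * (2 * α + 3 * β₁ * (i : F) + (2 - β₁) * (j : F) + (2 + β₁) * (k : F)))
    (hne : ∃ i j : ℤ, i ≠ 0 ∧ d (i, j) ≠ 0) :
    (β₁ = -2 ∨ β₁ = 1 / 2) ∧ (β₁ ≠ -2 → ∀ i j : ℤ, d (i, j) = d (0, i + j)) := by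
  have key : β₁ ≠ -2 → ∀ i j : ℤ, d (i, j) = d (0, i + j) := by
    intro hβ i j
    have hβ' : 2 + β₁ ≠ 0 := fun h => hβ (by linear_combination h)
    have h₀ := hd i j 0
    have h₁ := hd i j 1
    push_cast at h₀ h₁
    exact mul_right_cancel₀ hβ' (by linear_combination h₁ - h₀)
  refine ⟨or_iff_not_imp_left.mpr fun hβ => ?_, key⟩
  obtain ⟨i, j, hi, hij⟩ := hne
  have hi' : (i : F) ≠ 0 := Int.cast_ne_zero.mpr hi
  have h₀ := hd i j 0
  rw [← key hβ i j] at h₀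
  have h : (2 - 4 * β₁) * (d (i, j) * (i : F)) = 0 := by linear_combination h₀
  have h' := (mul_eq_zero.mp h).resolve_right (mul_ne_zero hij hi')
  linear_combination (-1 / 4 : F) * h'
end

section
/- Let α ∈ F∖{0} and suppose d′ : ℤ×ℤ → F satisfies d′(i,i) = 0 for all i ∈ ℤ and (−α+i)d′(i+k,j) + (−α+j)d′(i,j+k) = (−2α+i+j+k)d′(i,j) for all i,j,k ∈ ℤ. Then there exists λ ∈ F such that d′(i,j) = λ(j−i) for all i,j ∈ ℤ; in particular the solution space of this system is one-dimensional, spanned by (i,j) ↦ j−i. -/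
/-- A solution of the system is antisymmetric. -/
theorem antisymm_of_system {F : Type*} [Field F] [CharZero F] (α : F) (d : ℤ × ℤ → F)
    (h0 : ∀ i : ℤ, d (i, i) = 0)
    (hd : ∀ i j k : ℤ,
      (-α + (i : F)) * d (i + k, j) + (-α + (j : F)) * d (i, j + k) =
      (-2 * α + (i : F) + (j : F) + (k : F)) * d (i, j)) (i j : ℤ) :
    d (i, j) + d (j, i) = 0 := by
  have key : ∀ i j : ℤ, (-α + (i : F)) * (d (i, j) + d (j, i)) = 0 := fun i j => by
    have h := hd i i (j - i)
    rw [add_sub_cancel, h0] at h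
    linear_combination h
  rcases eq_or_ne i j with rfl | hij
  · simp [h0]
  by_contra hne
  have hi := (mul_eq_zero.mp (key i j)).resolve_right hne
  have hj := (mul_eq_zero.mp (key j i)).resolve_right (by rwa [add_comm])
  refine hij (Int.cast_injective (α := F) ?_)
  linear_combination hi - hj

/-- A function on `ℤ` that is additive on all pairs whose sum avoids one given value is additive. -/
theorem additive_of_additive_off_value {F : Type*} [Field F] [CharZero F] (c : F) (f : ℤ → F)
    (hf : ∀ j k : ℤ, (j : F) + k ≠ c → f (j + k) = f j + f k) (j k : ℤ) :
    f (j + k) = f j + f k := by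
  by_cases hc : (j : F) + k = c
  · obtain ⟨m, hm0, hmj⟩ : ∃ m : ℤ, m ≠ 0 ∧ m ≠ j := by
      rcases eq_or_ne j 1 with rfl | h
      · exact ⟨2, by norm_num, by norm_num⟩
      · exact ⟨1, one_ne_zero, h.symm⟩
    have hm0' : (m : F) ≠ 0 := Int.cast_ne_zero.mpr hm0
    have hmj' : (m : F) ≠ j := fun h => hmj (Int.cast_injective h)
    have h1 := hf (j + k) m fun h => hm0' (by push_cast at h; linear_combination h - hc)
    have h2 := hf j (k + m) fun h => hm0' (by push_cast at h; linear_combination h - hc)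
    have h3 := hf k m fun h => hmj' (by linear_combination h - hc)
    rw [← add_assoc] at h2
    linear_combination h2 + h3 - h1
  · exact hf j k hc

/-- Every solution of the system is a multiple of `(i, j) ↦ j - i`. -/
theorem exists_eq_mul_sub_of_system {F : Type*} [Field F] [CharZero F] (α : F) (hα : α ≠ 0)
    (d : ℤ × ℤ → F) (h0 : ∀ i : ℤ, d (i, i) = 0)
    (hd : ∀ i j k : ℤ,
      (-α + (i : F)) * d (i + k, j) + (-α + (j : F)) * d (i, j + k) =
      (-2 * α + (i : F) + (j : F) + (k : F)) * d (i, j)) :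
    ∃ l : F, ∀ i j : ℤ, d (i, j) = l * ((j : F) - (i : F)) := by
  have hrow : ∀ k j : ℤ, α * d (k, j) =
      ((j : F) - α) * d (0, j + k) - ((j : F) + k - 2 * α) * d (0, j) := fun k j => by
    have h := hd 0 j k
    rw [zero_add, Int.cast_zero] at h
    linear_combination -h
  have hadd := additive_of_additive_off_value (2 * α) (fun j => d (0, j)) fun j k hjk => by
    refine mul_left_cancel₀ (sub_ne_zero.mpr hjk) ?_
    have h := hrow j k
    rw [add_comm k j] at h
    linear_combination α * antisymm_of_system α d h0 hd k j - hrow k j - h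
  have hlin : ∀ j : ℤ, d (0, j) = j * d (0, 1) := fun j => by
    simpa using map_zsmul (AddMonoidHom.mk' (fun j => d (0, j)) hadd) j 1
  refine ⟨d (0, 1), fun i j => mul_left_cancel₀ hα ?_⟩
  rw [hrow, hlin (j + i), hlin j]
  push_cast
  ring

theorem stmt_16 {F : Type*} [Field F] [CharZero F] (α : F) (hα : α ≠ 0) (d : ℤ × ℤ → F)
    (h0 : ∀ i : ℤ, d (i, i) = 0)
    (hd : ∀ i j k : ℤ,
      (-α + (i : F)) * d (i + k, j) + (-α + (j : F)) * d (i, j + k) =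
      (-2 * α + (i : F) + (j : F) + (k : F)) * d (i, j)) :
    (∃ l : F, ∀ i j : ℤ, d (i, j) = l * ((j : F) - (i : F))) ∧
    {e : ℤ × ℤ → F |
        (∀ i : ℤ, e (i, i) = 0) ∧
        ∀ i j k : ℤ,
          (-α + (i : F)) * e (i + k, j) + (-α + (j : F)) * e (i, j + k) =
          (-2 * α + (i : F) + (j : F) + (k : F)) * e (i, j)} =
      Set.range fun l : F => fun p : ℤ × ℤ => l * ((p.2 : F) - (p.1 : F)) := by
  refine ⟨exists_eq_mul_sub_of_system α hα d h0 hd, Set.ext fun e => ⟨?_, ?_⟩⟩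
  · rintro ⟨he0, he⟩
    obtain ⟨l, hl⟩ := exists_eq_mul_sub_of_system α hα e he0 he
    exact ⟨l, funext fun p => (hl p.1 p.2).symm⟩
  · rintro ⟨l, rfl⟩
    refine ⟨fun i => by simp, fun i j k => ?_⟩
    push_cast
    ring
end
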